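/- arXiv:2004.07220 — 6 statements merged into one kernel-verified Lean document; each statement's English description precedes it below -/
import Mathlib

section
/- There exists a universal constant C > 0 with the following property. For all integers 1 ≤ k ≤ n, every nonnegative function μ : 𝒞(n,k) → ℝ≥0, not identically zero, whose generating polynomial g_μ is log-concave, every starting set S₀ ∈ 𝒞(n,k) with μ(S₀) > 0, every ε ∈ (0,1), and every integer t ≥ C·k·(log k + log(1/ε) + 1), the t-step distribution of the down-up walk started at S₀ satisfies ‖Pᵗ(S₀,·) − π_μ‖_TV ≤ ε. (In other words, the down-up walk mixes in time O(k·log(k/ε)), independently of n and of the starting point.) -/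
open Finset

/-- Generating polynomial `g_μ(x) = ∑_{S ∈ 𝒞(n,k)} μ(S) ∏_{i∈S} x_i`. -/
noncomputable def genPoly (n k : ℕ) (μ : Finset (Fin n) → ℝ) (x : Fin n → ℝ) : ℝ :=
  ∑ S ∈ Finset.powersetCard k (Finset.univ : Finset (Fin n)), μ S * ∏ i ∈ S, x i

/-- `g` is log-concave on the nonnegative orthant (using real powers). -/
def LogConcaveOn {n : ℕ} (g : (Fin n → ℝ) → ℝ) : Prop :=
  ∀ x y : Fin n → ℝ, (∀ i, 0 ≤ x i) → (∀ i, 0 ≤ y i) →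
    ∀ l : ℝ, 0 ≤ l → l ≤ 1 →
      g x ^ l * g y ^ (1 - l) ≤ g (fun i => l * x i + (1 - l) * y i)

/-- The down-up walk transition kernel for `μ` on `k`-element subsets of `ground`:
for `μ(S) ≠ 0`, `P(S,S') = (1/k) ∑_{e ∈ S, S∖{e} ⊆ S'} μ(S') / ∑_{S'' ⊇ S∖{e}} μ(S'')`;
for `μ(S) = 0`, `P(S,S) = 1`. -/
noncomputable def downUp {α : Type*} [DecidableEq α] (ground : Finset α) (k : ℕ)
    (μ : Finset α → ℝ) (S S' : Finset α) : ℝ :=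
  if μ S = 0 then (if S' = S then 1 else 0)
  else (1 / (k : ℝ)) * ∑ e ∈ S,
    (if S \ {e} ⊆ S' then
      μ S' / ∑ S'' ∈ (ground.powersetCard k).filter (fun S'' => S \ {e} ⊆ S''), μ S''
    else 0)

/-- The distribution of the down-up walk after `t` steps started from `S₀`. -/
noncomputable def walkDist {α : Type*} [DecidableEq α] (ground : Finset α) (k : ℕ)
    (μ : Finset α → ℝ) (S₀ : Finset α) : ℕ → Finset α → ℝ
  | 0 => fun S => if S = S₀ then 1 else 0
  | t + 1 => fun S' =>
      ∑ S ∈ ground.powersetCard k, walkDist ground k μ S₀ t S * downUp ground k μ S S'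

/-- Total variation distance between two functions on the `k`-subsets of `ground`. -/
noncomputable def tvDist {α : Type*} [DecidableEq α] (ground : Finset α) (k : ℕ)
    (ν π : Finset α → ℝ) : ℝ :=
  (1 / 2) * ∑ S ∈ ground.powersetCard k, |ν S - π S|

/-- The normalized stationary distribution `π_μ(S) = μ(S) / ∑_{S'} μ(S')`. -/
noncomputable def statDist {α : Type*} [DecidableEq α] (ground : Finset α) (k : ℕ)
    (μ : Finset α → ℝ) (S : Finset α) : ℝ :=
  μ S / ∑ S' ∈ ground.powersetCard k, μ S'

/-- The total weight of the `k`-sets containing `R`. -/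
noncomputable def upSum {α : Type*} [Fintype α] [DecidableEq α] (k : ℕ) (w : Finset α → ℝ)
    (R : Finset α) : ℝ :=
  ∑ S ∈ (powersetCard k (univ : Finset α)).filter (fun S => R ⊆ S), w S

/-- The generating polynomial of the link of `R`. -/
noncomputable def linkPoly {α : Type*} [Fintype α] [DecidableEq α] (k : ℕ) (w : Finset α → ℝ)
    (R : Finset α) (z : α → ℝ) : ℝ :=
  ∑ S ∈ (powersetCard k (univ : Finset α)).filter (fun S => R ⊆ S), w S * ∏ i ∈ S \ R, z i

/-- At every nonvanishing link, the logarithm of the generating polynomial lies below its tangent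
at the all-ones point. -/
def LinkTangentBound {α : Type*} [Fintype α] [DecidableEq α] (k : ℕ) (w : Finset α → ℝ) : Prop :=
  ∀ (R : Finset α) (z : α → ℝ), (∀ i, 0 ≤ z i) → 0 < upSum k w R →
    linkPoly k w R z ≤
      upSum k w R * Real.exp (∑ i ∈ univ \ R, upSum k w (insert i R) / upSum k w R * (z i - 1))

theorem sum_upSum_insert {α : Type*} [Fintype α] [DecidableEq α] (k : ℕ) (w : Finset α → ℝ)
    (R : Finset α) (c : α → ℝ) :
    ∑ i ∈ univ \ R, upSum k w (insert i R) * c i =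
      ∑ S ∈ (powersetCard k (univ : Finset α)).filter (fun S => R ⊆ S),
        w S * ∑ i ∈ S \ R, c i := by
  simp only [upSum, Finset.sum_mul, Finset.mul_sum]
  apply Finset.sum_comm'
  intro i S
  simp only [mem_sdiff, mem_univ, true_and, mem_filter, mem_powersetCard_univ, insert_subset_iff]
  tauto

theorem linkPoly_one {α : Type*} [Fintype α] [DecidableEq α] (k : ℕ) (w : Finset α → ℝ)
    (R : Finset α) : linkPoly k w R (fun _ => 1) = upSum k w R := by
  simp [linkPoly, upSum]

theorem linkPoly_nonneg {α : Type*} [Fintype α] [DecidableEq α] {k : ℕ} {w : Finset α → ℝ}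
    (hw : ∀ S : Finset α, S.card = k → 0 ≤ w S) (R : Finset α) {z : α → ℝ} (hz : ∀ i, 0 ≤ z i) :
    0 ≤ linkPoly k w R z := by
  refine Finset.sum_nonneg fun S hS => mul_nonneg (hw S ?_) (Finset.prod_nonneg fun i _ => hz i)
  simpa using (mem_filter.1 hS).1

/-- Scaling the coordinates outside `R` by `c` and dividing by the leading power of `c` gives a
polynomial in `c` whose value at `0` is the link polynomial. -/
theorem genPoly_scaled {n k : ℕ} (μ : Finset (Fin n) → ℝ) {R : Finset (Fin n)} (z : Fin n → ℝ)
    (hR : R.card ≤ k) (c : ℝ) :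
    genPoly n k μ (fun i => if i ∈ R then 1 else c * z i) =
      c ^ (k - R.card) * ∑ S ∈ powersetCard k univ,
        μ S * (c ^ ((S \ R).card - (k - R.card)) * ∏ i ∈ S \ R, z i) := by
  rw [genPoly, Finset.mul_sum]
  refine Finset.sum_congr rfl fun S hS => ?_
  have hk : S.card = k := by simpa using hS
  have h1 : k - R.card ≤ (S \ R).card := by
    have := Finset.le_card_sdiff R S
    omega
  have h2 : ∏ i ∈ S, (if i ∈ R then 1 else c * z i) = c ^ (S \ R).card * ∏ i ∈ S \ R, z i := by
    rw [Finset.prod_ite, Finset.prod_const_one, one_mul, Finset.prod_mul_distrib,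
      Finset.prod_const, Finset.sdiff_eq_filter]
  rw [h2, ← Nat.sub_add_cancel h1, pow_add]
  simp only [Nat.add_sub_cancel]
  ring

theorem linkPoly_eq_sum {n k : ℕ} (μ : Finset (Fin n) → ℝ) {R : Finset (Fin n)} (z : Fin n → ℝ)
    (hR : R.card ≤ k) :
    ∑ S ∈ powersetCard k univ,
        μ S * ((0 : ℝ) ^ ((S \ R).card - (k - R.card)) * ∏ i ∈ S \ R, z i) =
      linkPoly k μ R z := by
  rw [linkPoly, Finset.sum_filter]
  refine Finset.sum_congr rfl fun S hS => ?_
  have hk : S.card = k := by simpa using hS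
  split_ifs with h
  · rw [Finset.card_sdiff_of_subset h, hk]
    simp
  · have h1 : (S \ R).card - (k - R.card) ≠ 0 := by
      have h3 := Finset.card_sdiff_add_card_inter S R
      have h4 : (S ∩ R).card < R.card := Finset.card_lt_card
        ⟨Finset.inter_subset_right, fun h5 => h (h5.trans Finset.inter_subset_left)⟩
      omega
    simp [zero_pow h1]

theorem linkPoly_logConcave {n k : ℕ} {μ : Finset (Fin n) → ℝ}
    (hμ : ∀ S : Finset (Fin n), S.card = k → 0 ≤ μ S) (hg : LogConcaveOn (genPoly n k μ))
    {R : Finset (Fin n)} (hR : R.card ≤ k) : LogConcaveOn (linkPoly k μ R) := by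
  intro x y hx hy l hl0 hl1
  let H : (Fin n → ℝ) → ℝ → ℝ := fun z c => ∑ S ∈ powersetCard k univ,
        μ S * (c ^ ((S \ R).card - (k - R.card)) * ∏ i ∈ S \ R, z i)
  have hH0 : ∀ z, H z 0 = linkPoly k μ R z := fun z => linkPoly_eq_sum μ z hR
  have hcont : ∀ z, Continuous (H z) := fun z => by fun_prop
  have hnn : ∀ z : Fin n → ℝ, (∀ i, 0 ≤ z i) → ∀ c, 0 ≤ c → 0 ≤ H z c := fun z hz c hc => by
    refine Finset.sum_nonneg fun S hS => mul_nonneg (hμ S (by simpa using hS))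
      (mul_nonneg (pow_nonneg hc _) (Finset.prod_nonneg fun i _ => hz i))
  have key : ∀ c ∈ Set.Ioi (0 : ℝ),
      H x c ^ l * H y c ^ (1 - l) ≤ H (fun i => l * x i + (1 - l) * y i) c := by
    intro c hc
    have hc : 0 < c := hc
    have h := hg (fun i => if i ∈ R then 1 else c * x i) (fun i => if i ∈ R then 1 else c * y i)
      (fun i => by split_ifs; exacts [zero_le_one, mul_nonneg hc.le (hx i)])
      (fun i => by split_ifs; exacts [zero_le_one, mul_nonneg hc.le (hy i)]) l hl0 hl1
    have h2 : (fun i => l * (if i ∈ R then 1 else c * x i) +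
        (1 - l) * (if i ∈ R then 1 else c * y i)) =
        fun i => if i ∈ R then 1 else c * (l * x i + (1 - l) * y i) := by
      ext i
      split_ifs <;> ring
    rw [h2, genPoly_scaled μ _ hR, genPoly_scaled μ _ hR, genPoly_scaled μ _ hR] at h
    have hpos : 0 < c ^ (k - R.card) := pow_pos hc _
    change (c ^ (k - R.card) * H x c) ^ l * (c ^ (k - R.card) * H y c) ^ (1 - l) ≤
      c ^ (k - R.card) * H _ c at h
    rw [Real.mul_rpow hpos.le (hnn x hx c hc.le), Real.mul_rpow hpos.le (hnn y hy c hc.le)] at h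
    have h3 : (c ^ (k - R.card)) ^ l * (c ^ (k - R.card)) ^ (1 - l) = c ^ (k - R.card) := by
      rw [← Real.rpow_add hpos]
      simp
    refine le_of_mul_le_mul_left ?_ hpos
    calc _ = ((c ^ (k - R.card)) ^ l * (c ^ (k - R.card)) ^ (1 - l)) *
          (H x c ^ l * H y c ^ (1 - l)) := by rw [h3]
      _ = _ := by ring
      _ ≤ _ := h
  have hl : Continuous fun c => H x c ^ l * H y c ^ (1 - l) :=
    ((hcont x).rpow_const fun _ => Or.inr hl0).mul
      ((hcont y).rpow_const fun _ => Or.inr (sub_nonneg.2 hl1))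
  have := ContinuousWithinAt.closure_le (f := fun c => H x c ^ l * H y c ^ (1 - l))
    (g := H (fun i => l * x i + (1 - l) * y i)) (s := Set.Ioi 0) (x := (0 : ℝ))
    (by simp) hl.continuousWithinAt (hcont _).continuousWithinAt key
  simpa only [hH0] using this

theorem hasDerivAt_nonneg_of_right {f : ℝ → ℝ} {f' : ℝ} (hf : HasDerivAt f f' 0) (h0 : f 0 = 0)
    (hnn : ∀ s, 0 < s → s ≤ 1 → 0 ≤ f s) : 0 ≤ f' := by
  refine ge_of_tendsto hf.tendsto_slope_zero_right ?_
  filter_upwards [Ioc_mem_nhdsGT (zero_lt_one (α := ℝ))] with s hs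
  simp only [zero_add, h0, sub_zero, smul_eq_mul]
  exact mul_nonneg (inv_nonneg.2 hs.1.le) (hnn s hs.1 hs.2)

theorem hasDerivAt_linkPoly_line {n k : ℕ} (μ : Finset (Fin n) → ℝ) (R : Finset (Fin n))
    (z : Fin n → ℝ) :
    HasDerivAt (fun s : ℝ => linkPoly k μ R (fun i => s * z i + (1 - s) * 1))
      (∑ S ∈ (powersetCard k (univ : Finset (Fin n))).filter (fun S => R ⊆ S),
        μ S * ∑ i ∈ S \ R, (z i - 1)) 0 := by
  unfold linkPoly
  refine HasDerivAt.fun_sum fun S _ => HasDerivAt.const_mul _ ?_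
  have h1 : ∀ i ∈ S \ R, HasDerivAt (fun s : ℝ => s * z i + (1 - s) * 1) (z i - 1) 0 := by
    intro i _
    have := ((hasDerivAt_id (0 : ℝ)).mul_const (z i)).add
      (((hasDerivAt_id (0 : ℝ)).const_sub 1).mul_const 1)
    exact this.congr_deriv (by ring)
  have := HasDerivAt.fun_finsetProd h1
  simpa using this

theorem linkTangentBound_of_logConcave {n k : ℕ} {μ : Finset (Fin n) → ℝ}
    (hμ : ∀ S : Finset (Fin n), S.card = k → 0 ≤ μ S) (hg : LogConcaveOn (genPoly n k μ)) :
    LinkTangentBound k μ := by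
  intro R z hz hR
  have hRk : R.card ≤ k := by
    by_contra h
    refine hR.ne' (Finset.sum_eq_zero fun S hS => ?_)
    simp only [mem_filter, mem_powersetCard_univ] at hS
    exact absurd (Finset.card_le_card hS.2) (by omega)
  have hlc := linkPoly_logConcave hμ hg hRk
  rcases (linkPoly_nonneg hμ R hz).eq_or_lt with h0 | h0
  · rw [← h0]; positivity
  set a := upSum k μ R with ha
  set u := linkPoly k μ R z / a with hu
  have hupos : 0 < u := div_pos h0 hR
  have hd2 : HasDerivAt (fun s : ℝ => a * u ^ s) (a * Real.log u) 0 := by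
    have := (Real.hasStrictDerivAt_const_rpow hupos 0).hasDerivAt.const_mul a
    simpa using this
  have hd := (hasDerivAt_linkPoly_line (k := k) μ R z).sub hd2
  have hD := hasDerivAt_nonneg_of_right hd (by simp [linkPoly_one, ← ha]) (by
    intro s hs0 hs1
    have h := hlc z (fun _ => 1) hz (fun _ => zero_le_one) s hs0.le hs1
    rw [linkPoly_one, ← ha] at h
    have h2 : a * u ^ s = linkPoly k μ R z ^ s * a ^ (1 - s) := by
      rw [hu, Real.div_rpow h0.le hR.le, Real.rpow_sub hR, Real.rpow_one]
      ring
    simp only [Pi.sub_apply]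
    rw [h2]
    linarith)
  rw [← sum_upSum_insert] at hD
  have hlog : Real.log u ≤ ∑ i ∈ univ \ R, upSum k μ (insert i R) / a * (z i - 1) := by
    have h3 : ∑ i ∈ univ \ R, upSum k μ (insert i R) / a * (z i - 1) =
        (∑ i ∈ univ \ R, upSum k μ (insert i R) * (z i - 1)) / a := by
      rw [Finset.sum_div]
      exact Finset.sum_congr rfl fun i _ => by ring
    rw [h3, le_div_iff₀ hR]
    linarith
  have h4 := Real.exp_le_exp.2 hlog
  rw [Real.exp_log hupos, hu, div_le_iff₀ hR] at h4
  linarith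

theorem upSum_nonneg {α : Type*} [Fintype α] [DecidableEq α] {k : ℕ} {w : Finset α → ℝ}
    (hw : ∀ S : Finset α, S.card = k → 0 ≤ w S) (R : Finset α) : 0 ≤ upSum k w R :=
  Finset.sum_nonneg fun S hS => hw S (by simpa using (mem_filter.1 hS).1)

theorem upSum_anti {α : Type*} [Fintype α] [DecidableEq α] {k : ℕ} {w : Finset α → ℝ}
    (hw : ∀ S : Finset α, S.card = k → 0 ≤ w S) {R R' : Finset α} (h : R ⊆ R') :
    upSum k w R' ≤ upSum k w R := by
  refine Finset.sum_le_sum_of_subset_of_nonneg (fun S hS => ?_)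
    fun S hS _ => hw S (by simpa using (mem_filter.1 hS).1)
  simp only [mem_filter] at hS ⊢
  exact ⟨hS.1, h.trans hS.2⟩

theorem upSum_self {α : Type*} [Fintype α] [DecidableEq α] {k : ℕ} (w : Finset α → ℝ)
    {S : Finset α} (hS : S.card = k) : upSum k w S = w S := by
  have : (powersetCard k (univ : Finset α)).filter (fun T => S ⊆ T) = {S} := by
    ext T
    simp only [mem_filter, mem_powersetCard_univ, mem_singleton]
    constructor
    · rintro ⟨h1, h2⟩
      exact (Finset.eq_of_subset_of_card_le h2 (by omega)).symm
    · rintro rfl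
      exact ⟨hS, Subset.rfl⟩
  simp [upSum, this]

theorem le_upSum {α : Type*} [Fintype α] [DecidableEq α] {k : ℕ} {w : Finset α → ℝ}
    (hw : ∀ S : Finset α, S.card = k → 0 ≤ w S) {R S : Finset α} (hS : S.card = k) (h : R ⊆ S) :
    w S ≤ upSum k w R :=
  (upSum_self w hS).symm.le.trans (upSum_anti hw h)

theorem upSum_empty {α : Type*} [Fintype α] [DecidableEq α] (k : ℕ) (w : Finset α → ℝ) :
    upSum k w ∅ = ∑ S ∈ powersetCard k (univ : Finset α), w S := by
  simp [upSum]

/-- Approximate negative correlation of two elements in a link. -/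
theorem upSum_pair_mul_le {α : Type*} [Fintype α] [DecidableEq α] {k : ℕ} {w : Finset α → ℝ}
    (hw : ∀ S : Finset α, S.card = k → 0 ≤ w S) (hT : LinkTangentBound k w) {R : Finset α}
    {r f : α} (hrf : r ≠ f) (hr : r ∉ R) (hf : f ∉ R) :
    upSum k w (insert f (insert r R)) * upSum k w R ≤
      Real.exp 2 * upSum k w (insert r R) * upSum k w (insert f R) := by
  have hnn := upSum_nonneg hw
  rcases (hnn (insert f (insert r R))).eq_or_lt with h0 | h0
  · rw [← h0, zero_mul]
    exact mul_nonneg (mul_nonneg (Real.exp_pos _).le (hnn _)) (hnn _)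
  have hpr : 0 < upSum k w (insert r R) := h0.trans_le (upSum_anti hw (subset_insert _ _))
  have hpf : 0 < upSum k w (insert f R) :=
    h0.trans_le (upSum_anti hw (insert_subset_insert _ (subset_insert _ _)))
  have hpR : 0 < upSum k w R := hpr.trans_le (upSum_anti hw (subset_insert _ _))
  set a := upSum k w R with ha
  set b := upSum k w (insert r R) with hb
  set c := upSum k w (insert f R) with hc
  set d := upSum k w (insert f (insert r R)) with hd
  let z : α → ℝ := fun i => if i = r then a / b else if i = f then a / c else 1
  have hzr : z r = a / b := by simp [z]
  have hzf : z f = a / c := by simp [z, hrf.symm]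
  have hz1 : ∀ i, i ≠ r → i ≠ f → z i = 1 := fun i h1 h2 => by simp [z, h1, h2]
  have hz : ∀ i, 0 ≤ z i := fun i => by
    simp only [z]
    split_ifs <;> positivity
  have h1 := hT R z hz hpR
  have h2 : d * (a / b * (a / c)) ≤ linkPoly k w R z := by
    rw [hd, upSum, Finset.sum_mul]
    have hsub : (powersetCard k (univ : Finset α)).filter (fun S => insert f (insert r R) ⊆ S) ⊆
        (powersetCard k (univ : Finset α)).filter (fun S => R ⊆ S) := by
      intro S hS
      simp only [mem_filter] at hS ⊢
      exact ⟨hS.1, ((subset_insert _ _).trans (subset_insert _ _)).trans hS.2⟩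
    refine le_trans (le_of_eq ?_) (Finset.sum_le_sum_of_subset_of_nonneg hsub fun S hS _ =>
      mul_nonneg (hw S (by simpa using (mem_filter.1 hS).1)) (Finset.prod_nonneg fun i _ => hz i))
    refine Finset.sum_congr rfl fun S hS => ?_
    simp only [mem_filter, insert_subset_iff] at hS
    congr 1
    rw [← hzr, ← hzf, ← Finset.prod_pair hrf]
    refine Finset.prod_subset ?_ ?_
    · intro i hi
      simp only [mem_insert, mem_singleton] at hi
      rcases hi with rfl | rfl <;> simp [*]
    · intro i _ hi
      simp only [mem_insert, mem_singleton, not_or] at hi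
      exact hz1 i hi.1 hi.2
  have h3 : ∑ i ∈ univ \ R, upSum k w (insert i R) / a * (z i - 1) ≤ 2 := by
    have h4 : ∑ i ∈ ({r, f} : Finset α), upSum k w (insert i R) / a * (z i - 1) =
        ∑ i ∈ univ \ R, upSum k w (insert i R) / a * (z i - 1) := by
      refine Finset.sum_subset ?_ ?_
      · intro i hi
        simp only [mem_insert, mem_singleton] at hi
        rcases hi with rfl | rfl <;> simp [*]
      · intro i _ hi
        simp only [mem_insert, mem_singleton, not_or] at hi
        rw [hz1 i hi.1 hi.2]
        ring
    rw [← h4, Finset.sum_pair hrf, hzr, hzf, ← hb, ← hc]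
    have e1 : b / a * (a / b - 1) = 1 - b / a := by field_simp
    have e2 : c / a * (a / c - 1) = 1 - c / a := by field_simp
    have p1 : 0 ≤ b / a := by positivity
    have p2 : 0 ≤ c / a := by positivity
    linarith
  have h5 : d * (a / b * (a / c)) ≤ a * Real.exp 2 :=
    (h2.trans h1).trans (mul_le_mul_of_nonneg_left (Real.exp_le_exp.2 h3) hpR.le)
  have h6 : d * (a / b * (a / c)) = a * ((d * a) / (b * c)) := by field_simp
  rw [h6] at h5
  have h7 := le_of_mul_le_mul_left h5 hpR
  rw [div_le_iff₀ (mul_pos hpr hpf)] at h7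
  linarith

/-- Conditioning on further elements increases the probability of `f` at most exponentially. -/
theorem upSum_insert_mul_le {α : Type*} [Fintype α] [DecidableEq α] {k : ℕ} {w : Finset α → ℝ}
    (hw : ∀ S : Finset α, S.card = k → 0 ≤ w S) (hT : LinkTangentBound k w) {R : Finset α}
    {f : α} (hf : f ∉ R) (D : Finset α) (hD : Disjoint D R) (hfD : f ∉ D) :
    upSum k w (insert f (D ∪ R)) * upSum k w R ≤
      Real.exp 2 ^ D.card * upSum k w (insert f R) * upSum k w (D ∪ R) := by
  have hnn := upSum_nonneg hw
  induction D using Finset.induction_on with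
  | empty => simp
  | insert r D hr ih =>
    rw [disjoint_insert_left] at hD
    rw [mem_insert, not_or] at hfD
    have ih := ih hD.2 hfD.2
    rw [insert_union, card_insert_of_notMem hr]
    set X := D ∪ R with hX
    have hrX : r ∉ X := by simp [hX, hr, hD.1]
    have hfX : f ∉ X := by simp [hX, hf, hfD.2]
    have h1 := upSum_pair_mul_le hw hT (Ne.symm hfD.1) hrX hfX
    rcases (hnn X).eq_or_lt with h0 | h0
    · have h2 : upSum k w (insert f (insert r X)) = 0 :=
        le_antisymm (h0 ▸ upSum_anti hw ((subset_insert _ _).trans (subset_insert _ _))) (hnn _)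
      rw [h2, zero_mul]
      exact mul_nonneg (mul_nonneg (pow_nonneg (Real.exp_pos _).le _) (hnn _)) (hnn _)
    · refine le_of_mul_le_mul_right ?_ h0
      have hp : 0 ≤ Real.exp 2 * upSum k w (insert r X) :=
        mul_nonneg (Real.exp_pos _).le (hnn _)
      calc _ = upSum k w (insert f (insert r X)) * upSum k w X * upSum k w R := by ring
        _ ≤ Real.exp 2 * upSum k w (insert r X) * upSum k w (insert f X) * upSum k w R :=
          mul_le_mul_of_nonneg_right h1 (hnn _)
        _ = Real.exp 2 * upSum k w (insert r X) * (upSum k w (insert f X) * upSum k w R) := by ring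
        _ ≤ Real.exp 2 * upSum k w (insert r X) *
            (Real.exp 2 ^ D.card * upSum k w (insert f R) * upSum k w X) :=
          mul_le_mul_of_nonneg_left ih hp
        _ = _ := by ring

theorem upSum_insert_div_le {α : Type*} [Fintype α] [DecidableEq α] {k : ℕ} {w : Finset α → ℝ}
    (hw : ∀ S : Finset α, S.card = k → 0 ≤ w S) (hT : LinkTangentBound k w) {R R' : Finset α}
    {f : α} (hR : R ⊆ R') (hf : f ∉ R') (hk : R'.card ≤ k) (hpos : 0 < upSum k w R') :
    upSum k w (insert f R') / upSum k w R' ≤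
      Real.exp 2 ^ k * (upSum k w (insert f R) / upSum k w R) := by
  have hnn := upSum_nonneg hw
  have hRpos : 0 < upSum k w R := hpos.trans_le (upSum_anti hw hR)
  have h1 := upSum_insert_mul_le hw hT (fun h => hf (hR h)) (R' \ R) sdiff_disjoint
    (fun h => hf (mem_sdiff.1 h).1)
  rw [sdiff_union_of_subset hR] at h1
  have h2 : Real.exp 2 ^ (R' \ R).card ≤ Real.exp 2 ^ k :=
    pow_le_pow_right₀ (Real.one_le_exp (by norm_num)) ((card_le_card sdiff_subset).trans hk)
  rw [div_le_iff₀ hpos, ← mul_div_assoc, div_mul_eq_mul_div, le_div_iff₀ hRpos]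
  exact h1.trans (mul_le_mul_of_nonneg_right (mul_le_mul_of_nonneg_right h2 (hnn _)) (hnn _))

/-- One step of the down-up walk acting on observables of a pair `(S, F)`, where `S` is the current
set and `F` records the elements of `S` which have been added by the walk. -/
noncomputable def trackStep {α : Type*} [Fintype α] [DecidableEq α] (k : ℕ) (w : Finset α → ℝ) :
    Module.End ℝ (Finset α → Finset α → ℝ) where
  toFun h := fun S F => (1 / (k : ℝ)) * ∑ e ∈ S,
    ∑ S' ∈ (powersetCard k (univ : Finset α)).filter (fun S' => S \ {e} ⊆ S'),
      w S' / upSum k w (S \ {e}) * h S' (F \ {e} ∪ S' \ (S \ {e}))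
  map_add' h h' := by
    ext S F
    simp only [Pi.add_apply, mul_add, Finset.sum_add_distrib]
  map_smul' c h := by
    ext S F
    simp only [Pi.smul_apply, smul_eq_mul, RingHom.id_apply, Finset.mul_sum]
    refine Finset.sum_congr rfl fun e _ => Finset.sum_congr rfl fun S' _ => ?_
    ring

theorem trackStep_apply {α : Type*} [Fintype α] [DecidableEq α] (k : ℕ) (w : Finset α → ℝ)
    (h : Finset α → Finset α → ℝ) (S F : Finset α) :
    trackStep k w h S F = (1 / (k : ℝ)) * ∑ e ∈ S,
      ∑ S' ∈ (powersetCard k (univ : Finset α)).filter (fun S' => S \ {e} ⊆ S'),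
        w S' / upSum k w (S \ {e}) * h S' (F \ {e} ∪ S' \ (S \ {e})) := rfl

/-- The states the tracked walk can visit. -/
def TrackState {α : Type*} (k : ℕ) (w : Finset α → ℝ) (S F : Finset α) : Prop :=
  S.card = k ∧ 0 < w S ∧ F ⊆ S

theorem TrackState.upSum_pos {α : Type*} [Fintype α] [DecidableEq α] {k : ℕ} {w : Finset α → ℝ}
    (hw : ∀ S : Finset α, S.card = k → 0 ≤ w S) {S F : Finset α} (hS : TrackState k w S F)
    (e : α) : 0 < upSum k w (S \ {e}) :=
  hS.2.1.trans_le (le_upSum hw hS.1 sdiff_subset)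

theorem TrackState.step {α : Type*} [DecidableEq α] {k : ℕ} {w : Finset α → ℝ}
    {S F S' : Finset α} (hS : TrackState k w S F) {e : α} (hS' : S'.card = k)
    (hsub : S \ {e} ⊆ S') (hpos : 0 < w S') : TrackState k w S' (F \ {e} ∪ S' \ (S \ {e})) :=
  ⟨hS', hpos, union_subset ((sdiff_subset_sdiff hS.2.2 Subset.rfl).trans hsub) sdiff_subset⟩

theorem trackStep_mono {α : Type*} [Fintype α] [DecidableEq α] {k : ℕ} {w : Finset α → ℝ}
    (hw : ∀ S : Finset α, S.card = k → 0 ≤ w S) {h h' : Finset α → Finset α → ℝ}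
    (hh : ∀ S F, TrackState k w S F → h S F ≤ h' S F) {S F : Finset α}
    (hS : TrackState k w S F) : trackStep k w h S F ≤ trackStep k w h' S F := by
  simp only [trackStep_apply]
  refine mul_le_mul_of_nonneg_left (Finset.sum_le_sum fun e _ => Finset.sum_le_sum fun S' hS' => ?_)
    (by positivity)
  simp only [mem_filter, mem_powersetCard_univ] at hS'
  rcases (hw S' hS'.1).eq_or_lt with h0 | h0
  · simp [← h0]
  · exact mul_le_mul_of_nonneg_left (hh _ _ (hS.step hS'.1 hS'.2 h0))
      (div_nonneg h0.le (upSum_nonneg hw _))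

theorem trackStep_pow_mono {α : Type*} [Fintype α] [DecidableEq α] {k : ℕ} {w : Finset α → ℝ}
    (hw : ∀ S : Finset α, S.card = k → 0 ≤ w S) (t : ℕ) {h h' : Finset α → Finset α → ℝ}
    (hh : ∀ S F, TrackState k w S F → h S F ≤ h' S F) {S F : Finset α}
    (hS : TrackState k w S F) : (trackStep k w ^ t) h S F ≤ (trackStep k w ^ t) h' S F := by
  induction t generalizing S F with
  | zero => exact hh S F hS
  | succ t ih =>
    rw [pow_succ', Module.End.mul_apply, Module.End.mul_apply]
    exact trackStep_mono hw (fun S F hS => ih hS) hS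

theorem trackStep_pow_congr {α : Type*} [Fintype α] [DecidableEq α] {k : ℕ} {w : Finset α → ℝ}
    (hw : ∀ S : Finset α, S.card = k → 0 ≤ w S) (t : ℕ) {h h' : Finset α → Finset α → ℝ}
    (hh : ∀ S F, TrackState k w S F → h S F = h' S F) {S F : Finset α}
    (hS : TrackState k w S F) : (trackStep k w ^ t) h S F = (trackStep k w ^ t) h' S F :=
  le_antisymm (trackStep_pow_mono hw t (fun S F hS => (hh S F hS).le) hS)
    (trackStep_pow_mono hw t (fun S F hS => (hh S F hS).ge) hS)

theorem trackStep_pow_nonneg {α : Type*} [Fintype α] [DecidableEq α] {k : ℕ} {w : Finset α → ℝ}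
    (hw : ∀ S : Finset α, S.card = k → 0 ≤ w S) (t : ℕ) {h : Finset α → Finset α → ℝ}
    (hh : ∀ S F, 0 ≤ h S F) {S F : Finset α} (hS : TrackState k w S F) :
    0 ≤ (trackStep k w ^ t) h S F := by
  have := trackStep_pow_mono hw t (h := 0) (h' := h) (fun S F _ => hh S F) hS
  simpa using this

theorem sum_filter_div_upSum {α : Type*} [Fintype α] [DecidableEq α] {k : ℕ} {w : Finset α → ℝ}
    {R : Finset α} (hR : 0 < upSum k w R) :
    ∑ S' ∈ (powersetCard k (univ : Finset α)).filter (fun S' => R ⊆ S'),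
      w S' / upSum k w R = 1 := by
  rw [← Finset.sum_div]
  exact div_self hR.ne'

theorem sum_walkDist_mul {α : Type*} [Fintype α] [DecidableEq α] {k : ℕ} {w : Finset α → ℝ}
    (hw : ∀ S : Finset α, S.card = k → 0 ≤ w S) {S₀ : Finset α} (hS₀ : TrackState k w S₀ ∅)
    (t : ℕ) (h : Finset α → ℝ) :
    ∑ S ∈ powersetCard k univ, walkDist univ k w S₀ t S * h S =
      (trackStep k w ^ t) (fun S _ => h S) S₀ ∅ := by
  induction t generalizing h with
  | zero =>
    simp only [walkDist, ite_mul, one_mul, zero_mul, Finset.sum_ite_eq', mem_powersetCard_univ,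
      hS₀.1, if_true]
    rfl
  | succ t ih =>
    have h1 : ∑ S' ∈ powersetCard k univ, walkDist univ k w S₀ (t + 1) S' * h S' =
        ∑ S ∈ powersetCard k univ, walkDist univ k w S₀ t S *
          ∑ S' ∈ powersetCard k univ, downUp univ k w S S' * h S' := by
      simp only [walkDist, Finset.sum_mul, Finset.mul_sum]
      rw [Finset.sum_comm]
      simp only [mul_assoc]
    rw [h1, ih, pow_succ, Module.End.mul_apply]
    refine trackStep_pow_congr hw t (fun S F hS => ?_) hS₀
    simp only [downUp, hS.2.1.ne', if_false, trackStep_apply, mul_assoc, ← Finset.mul_sum]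
    congr 1
    simp only [Finset.sum_mul]
    rw [Finset.sum_comm]
    refine Finset.sum_congr rfl fun e _ => ?_
    conv_rhs => rw [Finset.sum_filter]
    refine Finset.sum_congr rfl fun S' _ => ?_
    simp only [ite_mul, zero_mul]
    rfl

/-- The elements of `A` not added by the walk disappear at rate `1 / k`. -/
theorem trackStep_card_sdiff_le {α : Type*} [Fintype α] [DecidableEq α] {k : ℕ}
    {w : Finset α → ℝ} (hk : 1 ≤ k) (hw : ∀ S : Finset α, S.card = k → 0 ≤ w S) {S F : Finset α}
    (hS : TrackState k w S F) :
    trackStep k w (fun S F => ((S \ F).card : ℝ)) S F ≤ (1 - 1 / (k : ℝ)) * (S \ F).card := by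
  have hkpos : (0 : ℝ) < k := by exact_mod_cast hk
  have h1 : ∀ e ∈ S,
      ∑ S' ∈ (powersetCard k (univ : Finset α)).filter (fun S' => S \ {e} ⊆ S'),
        w S' / upSum k w (S \ {e}) * ((S' \ (F \ {e} ∪ S' \ (S \ {e}))).card : ℝ) ≤
      (S \ F).card - if e ∈ S \ F then 1 else 0 := by
    intro e _
    have h2 : ∀ S' : Finset α, ((S' \ (F \ {e} ∪ S' \ (S \ {e}))).card : ℝ) ≤
        (S \ F).card - if e ∈ S \ F then 1 else 0 := by
      intro S'
      have h3 : S' \ (F \ {e} ∪ S' \ (S \ {e})) ⊆ (S \ F).erase e := by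
        intro x
        simp only [mem_sdiff, mem_union, mem_erase, mem_singleton]
        tauto
      have h4 := card_le_card h3
      rw [card_erase_eq_ite] at h4
      split_ifs at h4 ⊢ with h5
      · have h6 : 1 ≤ (S \ F).card := card_pos.2 ⟨e, h5⟩
        have : ((S' \ (F \ {e} ∪ S' \ (S \ {e}))).card : ℝ) ≤ ((S \ F).card - 1 : ℕ) := by
          exact_mod_cast h4
        rwa [Nat.cast_sub h6, Nat.cast_one] at this
      · simpa using h4
    calc _ ≤ ∑ S' ∈ (powersetCard k (univ : Finset α)).filter (fun S' => S \ {e} ⊆ S'),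
          w S' / upSum k w (S \ {e}) * ((S \ F).card - if e ∈ S \ F then 1 else 0) := by
          refine Finset.sum_le_sum fun S' hS' => mul_le_mul_of_nonneg_left (h2 S') ?_
          exact div_nonneg (hw S' (by simpa using (mem_filter.1 hS').1)) (upSum_nonneg hw _)
      _ = _ := by rw [← Finset.sum_mul, sum_filter_div_upSum (hS.upSum_pos hw e), one_mul]
  rw [trackStep_apply]
  calc _ ≤ 1 / (k : ℝ) * ∑ e ∈ S, (((S \ F).card : ℝ) - if e ∈ S \ F then 1 else 0) :=
        mul_le_mul_of_nonneg_left (Finset.sum_le_sum h1) (by positivity)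
    _ = _ := by
      rw [Finset.sum_sub_distrib, Finset.sum_const, hS.1, ← Finset.sum_filter, Finset.sum_const,
        Finset.filter_mem_eq_inter, inter_eq_right.2 sdiff_subset]
      simp only [nsmul_eq_mul, mul_one]
      field_simp

theorem trackStep_pow_card_sdiff_le {α : Type*} [Fintype α] [DecidableEq α] {k : ℕ}
    {w : Finset α → ℝ} (hk : 1 ≤ k) (hw : ∀ S : Finset α, S.card = k → 0 ≤ w S) {S₀ : Finset α}
    (hS₀ : TrackState k w S₀ ∅) (t : ℕ) :
    (trackStep k w ^ t) (fun S F => ((S \ F).card : ℝ)) S₀ ∅ ≤ (1 - 1 / (k : ℝ)) ^ t * k := by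
  have hk1 : 0 ≤ 1 - 1 / (k : ℝ) := by
    have : (1 : ℝ) ≤ k := by exact_mod_cast hk
    rw [sub_nonneg, div_le_one (by linarith)]
    exact this
  induction t with
  | zero => simp [hS₀.1]
  | succ t ih =>
    rw [pow_succ, Module.End.mul_apply]
    have h1 := trackStep_pow_mono hw t (h' := (1 - 1 / (k : ℝ)) • fun S F => ((S \ F).card : ℝ))
      (fun S F hS => trackStep_card_sdiff_le hk hw hS) hS₀
    rw [map_smul] at h1
    refine h1.trans ?_
    simp only [Pi.smul_apply, smul_eq_mul]
    rw [pow_succ]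
    nlinarith [mul_le_mul_of_nonneg_left ih hk1]

/-- The indicator that all elements of `A` have been added by the walk. -/
noncomputable def allAdded {α : Type*} [DecidableEq α] (A : Finset α) : Finset α → Finset α → ℝ :=
  fun _ F => if A ⊆ F then 1 else 0

theorem allAdded_nonneg {α : Type*} [DecidableEq α] (A S F : Finset α) : 0 ≤ allAdded A S F := by
  unfold allAdded
  split_ifs <;> norm_num

theorem trackStep_allAdded_le {α : Type*} [Fintype α] [DecidableEq α] {k : ℕ}
    {w : Finset α → ℝ} (hk : 1 ≤ k) (hw : ∀ S : Finset α, S.card = k → 0 ≤ w S)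
    (hT : LinkTangentBound k w) (A : Finset α) {S F : Finset α} (hS : TrackState k w S F) :
    trackStep k w (allAdded A) S F ≤ (1 - (A.card : ℝ) / k) * allAdded A S F +
      ∑ f ∈ A, Real.exp 2 ^ k * (upSum k w A / upSum k w (A.erase f)) *
        allAdded (A.erase f) S F := by
  have hkpos : (0 : ℝ) < k := by exact_mod_cast hk
  have hnn := upSum_nonneg hw
  set J : ℝ := ∑ f ∈ A, Real.exp 2 ^ k * (upSum k w A / upSum k w (A.erase f)) *
    allAdded (A.erase f) S F with hJ
  have hwS : ∀ e, ∀ S' ∈ (powersetCard k (univ : Finset α)).filter (fun S' => S \ {e} ⊆ S'),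
      0 ≤ w S' / upSum k w (S \ {e}) := fun e S' hS' =>
    div_nonneg (hw S' (by simpa using (mem_filter.1 hS').1)) (hnn _)
  have h1 : ∀ e ∈ S,
      ∑ S' ∈ (powersetCard k (univ : Finset α)).filter (fun S' => S \ {e} ⊆ S'),
        w S' / upSum k w (S \ {e}) * allAdded A S' (F \ {e} ∪ S' \ (S \ {e})) ≤
      (if e ∈ A then 0 else allAdded A S F) + J := by
    intro e he
    set R := S \ {e} with hR
    have hRcard : R.card + 1 = k := by
      rw [hR, card_sdiff_of_subset (singleton_subset_iff.2 he), card_singleton, hS.1]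
      omega
    have hRpos : 0 < upSum k w R := hS.upSum_pos hw e
    have h2 : ∀ S' ∈ (powersetCard k (univ : Finset α)).filter (fun S' => R ⊆ S'),
        allAdded A S' (F \ {e} ∪ S' \ R) ≤ (if e ∈ A then 0 else allAdded A S F) +
          ∑ f ∈ A, (if insert f R ⊆ S' then 1 else 0) *
            (if f ∉ R ∧ A.erase f ⊆ R then allAdded (A.erase f) S F else 0) := by
      intro S' hS'
      simp only [mem_filter, mem_powersetCard_univ] at hS'
      have hsum : 0 ≤ ∑ f ∈ A, (if insert f R ⊆ S' then (1 : ℝ) else 0) *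
            (if f ∉ R ∧ A.erase f ⊆ R then allAdded (A.erase f) S F else 0) := by
        refine Finset.sum_nonneg fun f _ => mul_nonneg (by split_ifs <;> norm_num) ?_
        split_ifs
        exacts [allAdded_nonneg _ _ _, le_rfl]
      have hfst : 0 ≤ if e ∈ A then 0 else allAdded A S F := by
        split_ifs
        exacts [le_rfl, allAdded_nonneg _ _ _]
      by_cases hA : A ⊆ F \ {e} ∪ S' \ R
      swap
      · rw [allAdded, if_neg hA]
        exact add_nonneg hfst hsum
      have hone : allAdded A S' (F \ {e} ∪ S' \ R) = 1 := if_pos hA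
      rw [hone]
      obtain ⟨f, hf⟩ : ∃ f, S' \ R = {f} := by
        rw [← card_eq_one, card_sdiff_of_subset hS'.2, hS'.1]
        omega
      have hfS' : f ∈ S' \ R := by rw [hf]; exact mem_singleton_self f
      rw [hf] at hA
      by_cases hfA : f ∈ A
      · have h3 : A.erase f ⊆ F \ {e} := by
          intro x hx
          rw [mem_erase] at hx
          rcases mem_union.1 (hA hx.2) with h | h
          · exact h
          · exact absurd (mem_singleton.1 h) hx.1
        refine le_add_of_nonneg_of_le hfst ?_
        have h4 := Finset.single_le_sum (f := fun f => (if insert f R ⊆ S' then (1 : ℝ) else 0) *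
            (if f ∉ R ∧ A.erase f ⊆ R then allAdded (A.erase f) S F else 0)) (s := A)
          (fun f _ => mul_nonneg (by split_ifs <;> norm_num)
            (by split_ifs; exacts [allAdded_nonneg _ _ _, le_rfl])) hfA
        refine le_trans (le_of_eq ?_) h4
        rw [if_pos (insert_subset (mem_sdiff.1 hfS').1 hS'.2),
          if_pos ⟨(mem_sdiff.1 hfS').2, h3.trans (sdiff_subset_sdiff hS.2.2 Subset.rfl)⟩,
          allAdded, if_pos (h3.trans sdiff_subset), one_mul]
      · have h3 : A ⊆ F \ {e} := by
          intro x hx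
          rcases mem_union.1 (hA hx) with h | h
          · exact h
          · exact absurd (mem_singleton.1 h ▸ hx) hfA
        refine le_add_of_le_of_nonneg ?_ hsum
        rw [if_neg fun h => by simpa using h3 h, allAdded, if_pos (h3.trans sdiff_subset)]
    calc _ ≤ ∑ S' ∈ (powersetCard k (univ : Finset α)).filter (fun S' => R ⊆ S'),
          w S' / upSum k w R * ((if e ∈ A then 0 else allAdded A S F) +
          ∑ f ∈ A, (if insert f R ⊆ S' then 1 else 0) *
            (if f ∉ R ∧ A.erase f ⊆ R then allAdded (A.erase f) S F else 0)) :=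
          Finset.sum_le_sum fun S' hS' => mul_le_mul_of_nonneg_left (h2 S' hS') (hwS e S' hS')
      _ = (if e ∈ A then 0 else allAdded A S F) + ∑ f ∈ A, upSum k w (insert f R) / upSum k w R *
            (if f ∉ R ∧ A.erase f ⊆ R then allAdded (A.erase f) S F else 0) := by
          simp only [mul_add, Finset.sum_add_distrib]
          rw [← Finset.sum_mul, sum_filter_div_upSum hRpos, one_mul]
          congr 1
          simp only [Finset.mul_sum]
          rw [Finset.sum_comm]
          refine Finset.sum_congr rfl fun f _ => ?_
          simp only [← mul_assoc]
          rw [← Finset.sum_mul]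
          congr 1
          simp only [mul_ite, mul_one, mul_zero]
          rw [← Finset.sum_filter, Finset.filter_filter, ← Finset.sum_div, upSum]
          congr 2
          ext T
          simp only [mem_filter, insert_subset_iff]
          tauto
      _ ≤ _ := by
          refine add_le_add_right (Finset.sum_le_sum fun f hf => ?_) _
          split_ifs with h
          · refine mul_le_mul_of_nonneg_right ?_ (allAdded_nonneg _ _ _)
            have := upSum_insert_div_le hw hT h.2 h.1 (by omega) hRpos
            rwa [insert_erase hf] at this
          · rw [mul_zero]
            exact mul_nonneg (mul_nonneg (pow_nonneg (Real.exp_pos _).le _)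
              (div_nonneg (hnn _) (hnn _))) (allAdded_nonneg _ _ _)
  rw [trackStep_apply]
  calc _ ≤ 1 / (k : ℝ) * ∑ e ∈ S, ((if e ∈ A then 0 else allAdded A S F) + J) :=
        mul_le_mul_of_nonneg_left (Finset.sum_le_sum h1) (by positivity)
    _ = _ := by
      rw [Finset.sum_add_distrib, Finset.sum_const, hS.1, nsmul_eq_mul, mul_add, ← mul_assoc,
        one_div_mul_cancel hkpos.ne', one_mul]
      congr 1
      by_cases hA : A ⊆ F
      · have h3 : ∑ e ∈ S, (if e ∈ A then 0 else allAdded A S F) =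
            ((S \ A).card : ℝ) * allAdded A S F := by
          rw [Finset.sum_ite, Finset.sum_const_zero, zero_add, Finset.sum_const,
            nsmul_eq_mul, Finset.sdiff_eq_filter]
        have h4 : ((S \ A).card : ℝ) = k - A.card := by
          have h5 := hA.trans hS.2.2
          rw [card_sdiff_of_subset h5, Nat.cast_sub (card_le_card h5), hS.1]
        rw [h3, h4]
        field_simp
      · simp [allAdded, hA]

theorem trackStep_pow_allAdded_le {α : Type*} [Fintype α] [DecidableEq α] {k : ℕ}
    {w : Finset α → ℝ} (hk : 1 ≤ k) (hw : ∀ S : Finset α, S.card = k → 0 ≤ w S)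
    (hT : LinkTangentBound k w) (hone : ∑ S ∈ powersetCard k (univ : Finset α), w S = 1)
    {S₀ : Finset α} (hS₀ : TrackState k w S₀ ∅) (t : ℕ) (A : Finset α) (hA : A.card ≤ k) :
    (trackStep k w ^ t) (allAdded A) S₀ ∅ ≤ (k * Real.exp 2 ^ k) ^ A.card * upSum k w A := by
  have hkpos : (0 : ℝ) < k := by exact_mod_cast hk
  have hnn := upSum_nonneg hw
  set B := Real.exp 2 ^ k with hB
  have hBpos : 0 < B := pow_pos (Real.exp_pos _) _
  induction t generalizing A with
  | zero =>
    change (if A ⊆ ∅ then (1 : ℝ) else 0) ≤ _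
    split_ifs with h
    · rw [subset_empty] at h
      subst h
      rw [upSum_empty, hone]
      simp
    · exact mul_nonneg (by positivity) (hnn _)
  | succ t ih =>
    rw [pow_succ, Module.End.mul_apply]
    have h1 := trackStep_pow_mono hw t (h' := (1 - (A.card : ℝ) / k) • allAdded A +
      ∑ f ∈ A, (B * (upSum k w A / upSum k w (A.erase f))) • allAdded (A.erase f))
      (fun S F hS => (trackStep_allAdded_le hk hw hT A hS).trans
        (by simp [Finset.sum_apply, hB])) hS₀
    simp only [map_add, map_sum, map_smul, Pi.add_apply, Pi.smul_apply, Finset.sum_apply,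
      smul_eq_mul] at h1
    refine h1.trans ?_
    have hc : 0 ≤ 1 - (A.card : ℝ) / k := by
      rw [sub_nonneg, div_le_one hkpos]
      exact_mod_cast hA
    have h2 : ∀ f ∈ A, B * (upSum k w A / upSum k w (A.erase f)) *
        (trackStep k w ^ t) (allAdded (A.erase f)) S₀ ∅ ≤
        B * ((k * B) ^ (A.card - 1) * upSum k w A) := by
      intro f hf
      have h3 := ih (A.erase f) ((card_le_card (erase_subset _ _)).trans hA)
      rw [card_erase_of_mem hf] at h3
      calc _ ≤ B * (upSum k w A / upSum k w (A.erase f)) *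
            ((k * B) ^ (A.card - 1) * upSum k w (A.erase f)) :=
            mul_le_mul_of_nonneg_left h3
              (mul_nonneg hBpos.le (div_nonneg (hnn _) (hnn _)))
        _ = B * ((k * B) ^ (A.card - 1) *
            (upSum k w A / upSum k w (A.erase f) * upSum k w (A.erase f))) := by ring
        _ ≤ _ := by
          refine mul_le_mul_of_nonneg_left (mul_le_mul_of_nonneg_left ?_ (by positivity)) hBpos.le
          rcases (hnn (A.erase f)).eq_or_lt with h0 | h0
          · rw [← h0, mul_zero]
            exact hnn _
          · rw [div_mul_cancel₀ _ h0.ne']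
    refine (add_le_add (mul_le_mul_of_nonneg_left (ih A hA) hc) (Finset.sum_le_sum h2)).trans ?_
    rw [Finset.sum_const, nsmul_eq_mul]
    rcases Nat.eq_zero_or_pos A.card with h0 | h0
    · simp [h0]
    · refine le_of_eq ?_
      obtain ⟨j, hj⟩ : ∃ j, A.card = j + 1 := ⟨A.card - 1, by omega⟩
      rw [hj, Nat.add_sub_cancel, pow_succ]
      field_simp
      ring

theorem upSum_eq_zero {α : Type*} [Fintype α] [DecidableEq α] {k : ℕ} {w v : Finset α → ℝ}
    (hw : ∀ S : Finset α, S.card = k → 0 ≤ w S)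
    (hvw : ∀ S : Finset α, S.card = k → w S = 0 → v S = 0) {R : Finset α}
    (h : upSum k w R = 0) : upSum k v R = 0 := by
  refine Finset.sum_eq_zero fun S hS => ?_
  simp only [mem_filter, mem_powersetCard_univ] at hS
  exact hvw S hS.1 (le_antisymm (h ▸ le_upSum hw hS.1 hS.2) (hw S hS.1))

theorem sum_upSum_insert_eq {α : Type*} [Fintype α] [DecidableEq α] (k : ℕ) (w : Finset α → ℝ)
    (R : Finset α) :
    ∑ i ∈ univ \ R, upSum k w (insert i R) = ((k : ℝ) - R.card) * upSum k w R := by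
  have h := sum_upSum_insert k w R (fun _ => 1)
  simp only [mul_one] at h
  rw [h, upSum, Finset.mul_sum]
  refine Finset.sum_congr rfl fun S hS => ?_
  simp only [mem_filter, mem_powersetCard_univ] at hS
  rw [Finset.sum_const, card_sdiff_of_subset hS.2, nsmul_eq_mul, mul_one,
    Nat.cast_sub (card_le_card hS.2), hS.1, mul_comm]

/-- Entropic independence of the link of `R`. -/
theorem link_entropy_le {α : Type*} [Fintype α] [DecidableEq α] {k : ℕ} {w v : Finset α → ℝ}
    (hw : ∀ S : Finset α, S.card = k → 0 ≤ w S) (hT : LinkTangentBound k w)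
    (hv : ∀ S : Finset α, S.card = k → 0 ≤ v S)
    (hvw : ∀ S : Finset α, S.card = k → w S = 0 → v S = 0) (R : Finset α) :
    ∑ i ∈ univ \ R, upSum k v (insert i R) *
        (Real.log (upSum k v (insert i R) / upSum k w (insert i R)) -
          Real.log (upSum k v R / upSum k w R)) ≤
      ∑ S ∈ (powersetCard k (univ : Finset α)).filter (fun S => R ⊆ S),
        v S * (Real.log (v S / w S) - Real.log (upSum k v R / upSum k w R)) := by
  have hnw := upSum_nonneg hw
  have hnv := upSum_nonneg hv
  have hpos : ∀ R, 0 < upSum k v R → 0 < upSum k w R := fun R h =>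
    (hnw R).lt_of_ne fun h0 => h.ne' (upSum_eq_zero hw hvw h0.symm)
  rw [sum_upSum_insert]
  rcases (hnv R).eq_or_lt with h0 | hb
  · have hz : ∀ S ∈ (powersetCard k (univ : Finset α)).filter (fun S => R ⊆ S), v S = 0 := by
      intro S hS
      simp only [mem_filter, mem_powersetCard_univ] at hS
      exact le_antisymm (h0 ▸ le_upSum hv hS.1 hS.2) (hv S hS.1)
    refine Finset.sum_le_sum fun S hS => ?_
    simp [hz S hS]
  have ha := hpos R hb
  set a := upSum k w R with ha'
  set b := upSum k v R with hb'
  let z : α → ℝ := fun i =>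
    (upSum k v (insert i R) / upSum k w (insert i R)) / (b / a)
  have hz : ∀ i, 0 ≤ z i := fun i =>
    div_nonneg (div_nonneg (hnv _) (hnw _)) (div_pos hb ha).le
  have hexp : ∑ i ∈ univ \ R, upSum k w (insert i R) / a * (z i - 1) = 0 := by
    have h1 : ∀ i ∈ univ \ R, upSum k w (insert i R) / a * (z i - 1) =
        upSum k v (insert i R) / b - upSum k w (insert i R) / a := by
      intro i _
      rcases (hnw (insert i R)).eq_or_lt with h0 | h0
      · simp [← h0, upSum_eq_zero hw hvw h0.symm]
      · simp only [z]
        field_simp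
    rw [Finset.sum_congr rfl h1, Finset.sum_sub_distrib, ← Finset.sum_div, ← Finset.sum_div,
      sum_upSum_insert_eq, sum_upSum_insert_eq, ← ha', ← hb']
    field_simp
    ring
  have hlink : linkPoly k w R z ≤ a := by
    have := hT R z hz ha
    rwa [hexp, Real.exp_zero, mul_one] at this
  have hterm : ∀ S ∈ (powersetCard k (univ : Finset α)).filter (fun S => R ⊆ S),
      v S - b / a * (w S * ∏ i ∈ S \ R, z i) ≤
        v S * (Real.log (v S / w S) - Real.log (b / a)) -
        v S * ∑ i ∈ S \ R, (Real.log (upSum k v (insert i R) / upSum k w (insert i R)) -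
          Real.log (b / a)) := by
    intro S hS
    simp only [mem_filter, mem_powersetCard_univ] at hS
    rcases (hv S hS.1).eq_or_lt with h0 | h0
    · rw [← h0]
      have : 0 ≤ b / a * (w S * ∏ i ∈ S \ R, z i) :=
        mul_nonneg (div_pos hb ha).le
          (mul_nonneg (hw S hS.1) (Finset.prod_nonneg fun i _ => hz i))
      linarith
    have hwS : 0 < w S := (hw S hS.1).lt_of_ne fun h => h0.ne' (hvw S hS.1 h.symm)
    have hbi : ∀ i ∈ S \ R, 0 < upSum k v (insert i R) / upSum k w (insert i R) := by
      intro i hi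
      have h1 : 0 < upSum k v (insert i R) :=
        h0.trans_le (le_upSum hv hS.1 (insert_subset (mem_sdiff.1 hi).1 hS.2))
      exact div_pos h1 (hpos _ h1)
    have hba := div_pos hb ha
    have hzi : ∀ i ∈ S \ R, 0 < z i := fun i hi => div_pos (hbi i hi) hba
    have hP : 0 < ∏ i ∈ S \ R, z i := Finset.prod_pos hzi
    have hlog : ∑ i ∈ S \ R, (Real.log (upSum k v (insert i R) / upSum k w (insert i R)) -
          Real.log (b / a)) = Real.log (∏ i ∈ S \ R, z i) := by
      rw [Real.log_prod fun i hi => (hzi i hi).ne']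
      exact Finset.sum_congr rfl fun i hi => (Real.log_div (hbi i hi).ne' hba.ne').symm
    have hvw' := div_pos h0 hwS
    rw [hlog, ← mul_sub, ← Real.log_div hvw'.ne' hba.ne',
      ← Real.log_div (div_pos hvw' hba).ne' hP.ne']
    refine le_trans (le_of_eq ?_) (mul_le_mul_of_nonneg_left
      (Real.one_sub_inv_le_log_of_pos (div_pos (div_pos hvw' hba) hP)) h0.le)
    field_simp
  have hsum := Finset.sum_le_sum hterm
  rw [Finset.sum_sub_distrib, Finset.sum_sub_distrib, ← Finset.mul_sum] at hsum
  change b - b / a * linkPoly k w R z ≤ _ at hsum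
  have h1 : b / a * linkPoly k w R z ≤ b := by
    calc _ ≤ b / a * a := mul_le_mul_of_nonneg_left hlink (div_pos hb ha).le
      _ = b := div_mul_cancel₀ _ ha.ne'
  linarith

theorem sum_powersetCard_sum_insert {α : Type*} [Fintype α] [DecidableEq α] (r : ℕ)
    (G : Finset α → ℝ) :
    ∑ R ∈ powersetCard r (univ : Finset α), ∑ i ∈ univ \ R, G (insert i R) =
      (r + 1) * ∑ R ∈ powersetCard (r + 1) (univ : Finset α), G R := by
  have h1 : ((r : ℝ) + 1) * ∑ R ∈ powersetCard (r + 1) (univ : Finset α), G R =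
      ∑ R ∈ powersetCard (r + 1) (univ : Finset α), ∑ i ∈ R, G R := by
    rw [Finset.mul_sum]
    refine Finset.sum_congr rfl fun R hR => ?_
    rw [Finset.sum_const, mem_powersetCard_univ.1 hR]
    simp
  rw [h1, Finset.sum_sigma', Finset.sum_sigma']
  refine Finset.sum_bij' (fun p _ => ⟨insert p.2 p.1, p.2⟩) (fun p _ => ⟨p.1.erase p.2, p.2⟩)
    ?_ ?_ ?_ ?_ ?_
  · rintro ⟨R, i⟩ h
    simp only [mem_sigma, mem_powersetCard_univ, mem_sdiff, mem_univ, true_and] at h ⊢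
    exact ⟨by rw [card_insert_of_notMem h.2, h.1], mem_insert_self _ _⟩
  · rintro ⟨R, i⟩ h
    simp only [mem_sigma, mem_powersetCard_univ, mem_sdiff, mem_univ, true_and] at h ⊢
    exact ⟨by rw [card_erase_of_mem h.2, h.1]; rfl, notMem_erase _ _⟩
  · rintro ⟨R, i⟩ h
    simp only [mem_sigma, mem_powersetCard_univ, mem_sdiff, mem_univ, true_and] at h ⊢
    simp [erase_insert h.2]
  · rintro ⟨R, i⟩ h
    simp only [mem_sigma] at h ⊢
    simp [insert_erase h.2]
  · rintro ⟨R, i⟩ _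
    rfl

theorem sum_powersetCard_sum_filter {α : Type*} [Fintype α] [DecidableEq α] (r k : ℕ)
    (G : Finset α → Finset α → ℝ) :
    ∑ R ∈ powersetCard r (univ : Finset α),
        ∑ S ∈ (powersetCard k (univ : Finset α)).filter (fun S => R ⊆ S), G R S =
      ∑ S ∈ powersetCard k (univ : Finset α), ∑ R ∈ powersetCard r S, G R S := by
  apply Finset.sum_comm'
  intro R S
  simp only [mem_filter, mem_powersetCard, subset_univ, true_and]
  tauto

/-- The entropy of `v` relative to `w` projected to level `r`. -/
noncomputable def levelEnt {α : Type*} [Fintype α] [DecidableEq α] (k : ℕ) (v w : Finset α → ℝ)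
    (r : ℕ) : ℝ :=
  ∑ R ∈ powersetCard r (univ : Finset α), upSum k v R * Real.log (upSum k v R / upSum k w R)

/-- The entropy of `v` relative to `w` on the `k`-sets. -/
noncomputable def relEnt {α : Type*} [Fintype α] (k : ℕ) (v w : Finset α → ℝ) : ℝ :=
  ∑ S ∈ powersetCard k (univ : Finset α), v S * Real.log (v S / w S)

theorem levelEnt_step {α : Type*} [Fintype α] [DecidableEq α] {k : ℕ} {w v : Finset α → ℝ}
    (hw : ∀ S : Finset α, S.card = k → 0 ≤ w S) (hT : LinkTangentBound k w)
    (hv : ∀ S : Finset α, S.card = k → 0 ≤ v S)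
    (hvw : ∀ S : Finset α, S.card = k → w S = 0 → v S = 0) (r : ℕ) :
    (r + 1) * levelEnt k v w (r + 1) - ((k : ℝ) - r) * levelEnt k v w r ≤
      k.choose r * relEnt k v w - levelEnt k v w r := by
  have h := Finset.sum_le_sum fun R (_ : R ∈ powersetCard r (univ : Finset α)) =>
    link_entropy_le hw hT hv hvw R
  simp only [mul_sub, Finset.sum_sub_distrib] at h
  rw [sum_powersetCard_sum_insert r
      (fun R => upSum k v R * Real.log (upSum k v R / upSum k w R)),
    sum_powersetCard_sum_filter] at h
  have h1 : ∑ R ∈ powersetCard r (univ : Finset α), ∑ i ∈ univ \ R,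
      upSum k v (insert i R) * Real.log (upSum k v R / upSum k w R) =
      ((k : ℝ) - r) * levelEnt k v w r := by
    rw [levelEnt, Finset.mul_sum]
    refine Finset.sum_congr rfl fun R hR => ?_
    rw [← Finset.sum_mul, sum_upSum_insert_eq, mem_powersetCard_univ.1 hR, mul_assoc]
  have h2 : ∑ S ∈ powersetCard k (univ : Finset α), ∑ R ∈ powersetCard r S,
      v S * Real.log (v S / w S) = k.choose r * relEnt k v w := by
    rw [relEnt, Finset.mul_sum]
    refine Finset.sum_congr rfl fun S hS => ?_
    rw [Finset.sum_const, card_powersetCard, mem_powersetCard_univ.1 hS, nsmul_eq_mul]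
  have h3 : ∑ R ∈ powersetCard r (univ : Finset α),
      ∑ S ∈ (powersetCard k (univ : Finset α)).filter (fun S => R ⊆ S),
        v S * Real.log (upSum k v R / upSum k w R) = levelEnt k v w r := by
    rw [levelEnt]
    refine Finset.sum_congr rfl fun R hR => ?_
    rw [← Finset.sum_mul, upSum]
  rw [h1, h2, h3] at h
  exact h

theorem levelEnt_pred_le {α : Type*} [Fintype α] [DecidableEq α] {k : ℕ} {w v : Finset α → ℝ}
    (hk : 1 ≤ k) (hw : ∀ S : Finset α, S.card = k → 0 ≤ w S) (hT : LinkTangentBound k w)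
    (hv : ∀ S : Finset α, S.card = k → 0 ≤ v S)
    (hvw : ∀ S : Finset α, S.card = k → w S = 0 → v S = 0)
    (hsum : ∑ S ∈ powersetCard k (univ : Finset α), v S =
      ∑ S ∈ powersetCard k (univ : Finset α), w S) :
    levelEnt k v w (k - 1) ≤ ((k : ℝ) - 1) * relEnt k v w := by
  obtain ⟨m, rfl⟩ : ∃ m, k = m + 1 := ⟨k - 1, by omega⟩
  have key : ∀ r ≤ m, (m.choose r : ℝ) * relEnt (m + 1) v w ≤
      (m + 1).choose r * relEnt (m + 1) v w - levelEnt (m + 1) v w r := by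
    intro r
    induction r with
    | zero =>
      intro _
      have h0 : levelEnt (m + 1) v w 0 = 0 := by
        simp only [levelEnt, powersetCard_zero, Finset.sum_singleton, upSum_empty, hsum]
        rcases eq_or_ne (∑ S ∈ powersetCard (m + 1) (univ : Finset α), w S) 0 with h | h
        · rw [h, zero_mul]
        · rw [div_self h, Real.log_one, mul_zero]
      simp [h0]
    | succ r ih =>
      intro hr
      have ih := ih (by omega)
      have h := levelEnt_step hw hT hv hvw r
      have c1 : ((m.choose (r + 1) : ℕ) : ℝ) * (r + 1) = m.choose r * (m - r) := by
        have := Nat.choose_succ_right_eq m r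
        rw [← Nat.cast_sub (by omega : r ≤ m)]
        exact_mod_cast this
      have c2 : (((m + 1).choose (r + 1) : ℕ) : ℝ) * (r + 1) = (m + 1).choose r * (m + 1 - r) := by
        have := Nat.choose_succ_right_eq (m + 1) r
        have e : ((m : ℝ) + 1 - r) = ((m + 1 - r : ℕ) : ℝ) := by
          rw [Nat.cast_sub (by omega : r ≤ m + 1)]
          push_cast
          ring
        rw [e]
        exact_mod_cast this
      have hmr : (0 : ℝ) ≤ m - r := sub_nonneg.2 (by exact_mod_cast (by omega : r ≤ m))
      have hr1 : (0 : ℝ) < r + 1 := by positivity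
      refine le_of_mul_le_mul_right ?_ hr1
      have h4 := mul_le_mul_of_nonneg_right ih hmr
      push_cast at h
      have e1 : (m.choose (r + 1) : ℝ) * relEnt (m + 1) v w * (r + 1) =
          m.choose r * (m - r) * relEnt (m + 1) v w := by rw [← c1]; ring
      have e2 : ((m + 1).choose (r + 1) : ℝ) * relEnt (m + 1) v w * (r + 1) =
          (m + 1).choose r * (m + 1 - r) * relEnt (m + 1) v w := by rw [← c2]; ring
      rw [sub_mul, e1, e2]
      linarith
  have h := key m le_rfl
  rw [Nat.choose_self, Nat.choose_succ_self_right] at h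
  simp only [Nat.add_sub_cancel]
  push_cast at h ⊢
  linarith

/-- The action of the down-up walk on weights. -/
noncomputable def pushWeight {α : Type*} [Fintype α] [DecidableEq α] (k : ℕ)
    (w v : Finset α → ℝ) : Finset α → ℝ :=
  fun S' => ∑ S ∈ powersetCard k (univ : Finset α), v S * downUp univ k w S S'

theorem walkDist_add {α : Type*} [Fintype α] [DecidableEq α] (k : ℕ) (w : Finset α → ℝ)
    (S₀ : Finset α) (s t : ℕ) :
    walkDist univ k w S₀ (s + t) = (pushWeight k w)^[t] (walkDist univ k w S₀ s) := by
  induction t with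
  | zero => rfl
  | succ t ih =>
    rw [Function.iterate_succ_apply', ← ih]
    rfl

theorem sum_sdiff_singleton {α : Type*} [DecidableEq α] {k : ℕ} {S : Finset α}
    (hk : 1 ≤ k) (hS : S.card = k) (g : Finset α → ℝ) :
    ∑ e ∈ S, g (S \ {e}) = ∑ R ∈ powersetCard (k - 1) S, g R := by
  refine Finset.sum_bij (fun e _ => S \ {e}) ?_ ?_ ?_ fun _ _ => rfl
  · intro e he
    rw [mem_powersetCard, card_sdiff_of_subset (singleton_subset_iff.2 he), hS, card_singleton]
    exact ⟨sdiff_subset, rfl⟩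
  · intro e he e' _ h
    by_contra hne
    have h1 : e ∈ S \ {e'} := by simp [he, hne]
    rw [← h] at h1
    simp at h1
  · intro R hR
    rw [mem_powersetCard] at hR
    obtain ⟨e, he⟩ : ∃ e, S \ R = {e} := by
      rw [← card_eq_one, card_sdiff_of_subset hR.1, hS, hR.2]
      omega
    have he' : e ∈ S \ R := by rw [he]; exact mem_singleton_self e
    exact ⟨e, (mem_sdiff.1 he').1, by rw [← he, Finset.sdiff_sdiff_eq_self hR.1]⟩

theorem pushWeight_eq {α : Type*} [Fintype α] [DecidableEq α] {k : ℕ} {w v : Finset α → ℝ}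
    (hk : 1 ≤ k) (hvw : ∀ S : Finset α, S.card = k → w S = 0 → v S = 0)
    (S' : Finset α) :
    pushWeight k w v S' =
      w S' * ∑ R ∈ powersetCard (k - 1) S', (1 / (k : ℝ)) * (upSum k v R / upSum k w R) := by
  have h1 : ∀ S ∈ powersetCard k (univ : Finset α), v S * downUp univ k w S S' =
      ∑ R ∈ powersetCard (k - 1) S,
        (if R ⊆ S' then v S * ((1 / (k : ℝ)) * (w S' / upSum k w R)) else 0) := by
    intro S hS
    rw [mem_powersetCard_univ] at hS
    rw [← sum_sdiff_singleton hk hS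
      (fun R => if R ⊆ S' then v S * ((1 / (k : ℝ)) * (w S' / upSum k w R)) else 0)]
    rcases eq_or_ne (w S) 0 with h0 | h0
    · simp [hvw S hS h0]
    · rw [downUp, if_neg h0, Finset.mul_sum, Finset.mul_sum]
      refine Finset.sum_congr rfl fun e _ => ?_
      rw [mul_ite, mul_zero, mul_ite, mul_zero]
      rfl
  rw [pushWeight, Finset.sum_congr rfl h1, ← sum_powersetCard_sum_filter]
  have h2 : powersetCard (k - 1) S' =
      (powersetCard (k - 1) (univ : Finset α)).filter (fun R => R ⊆ S') := by
    ext R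
    simp only [mem_filter, mem_powersetCard, subset_univ, true_and]
    tauto
  rw [h2, Finset.sum_filter, Finset.mul_sum]
  refine Finset.sum_congr rfl fun R _ => ?_
  split_ifs
  · rw [← Finset.sum_mul, ← upSum]
    ring
  · simp

theorem downUp_nonneg {α : Type*} [Fintype α] [DecidableEq α] {k : ℕ} {w : Finset α → ℝ}
    (hw : ∀ S : Finset α, S.card = k → 0 ≤ w S) (S : Finset α) {S' : Finset α}
    (hS' : S'.card = k) : 0 ≤ downUp univ k w S S' := by
  unfold downUp
  split_ifs
  · exact zero_le_one
  · exact le_rfl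
  · refine mul_nonneg (by positivity) (Finset.sum_nonneg fun e _ => ?_)
    split_ifs
    exacts [div_nonneg (hw S' hS') (upSum_nonneg hw _), le_rfl]

theorem pushWeight_nonneg {α : Type*} [Fintype α] [DecidableEq α] {k : ℕ} {w v : Finset α → ℝ}
    (hw : ∀ S : Finset α, S.card = k → 0 ≤ w S) (hv : ∀ S : Finset α, S.card = k → 0 ≤ v S)
    {S' : Finset α} (hS' : S'.card = k) : 0 ≤ pushWeight k w v S' :=
  Finset.sum_nonneg fun S hS =>
    mul_nonneg (hv S (mem_powersetCard_univ.1 hS)) (downUp_nonneg hw S hS')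

theorem upSum_mul_div {α : Type*} [Fintype α] [DecidableEq α] {k : ℕ} {w v : Finset α → ℝ}
    (hw : ∀ S : Finset α, S.card = k → 0 ≤ w S)
    (hvw : ∀ S : Finset α, S.card = k → w S = 0 → v S = 0) (R : Finset α) :
    upSum k w R * (upSum k v R / upSum k w R) = upSum k v R := by
  rcases eq_or_ne (upSum k w R) 0 with h | h
  · rw [h, zero_mul, upSum_eq_zero hw hvw h]
  · rw [mul_div_cancel₀ _ h]

theorem sum_pushWeight {α : Type*} [Fintype α] [DecidableEq α] {k : ℕ} {w v : Finset α → ℝ}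
    (hk : 1 ≤ k) (hw : ∀ S : Finset α, S.card = k → 0 ≤ w S)
    (hvw : ∀ S : Finset α, S.card = k → w S = 0 → v S = 0) :
    ∑ S ∈ powersetCard k univ, pushWeight k w v S = ∑ S ∈ powersetCard k univ, v S := by
  have hkpos : (0 : ℝ) < k := by exact_mod_cast hk
  have h1 : ∑ S ∈ powersetCard k univ, pushWeight k w v S =
      ∑ S ∈ powersetCard k univ, ∑ R ∈ powersetCard (k - 1) S,
        w S * ((1 / (k : ℝ)) * (upSum k v R / upSum k w R)) :=
    Finset.sum_congr rfl fun S hS => by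
      rw [pushWeight_eq hk hvw S, Finset.mul_sum]
  have h2 : ∀ R ∈ powersetCard (k - 1) (univ : Finset α),
      ∑ S ∈ (powersetCard k (univ : Finset α)).filter (fun S => R ⊆ S),
        w S * ((1 / (k : ℝ)) * (upSum k v R / upSum k w R)) =
      ∑ S ∈ (powersetCard k (univ : Finset α)).filter (fun S => R ⊆ S), (1 / (k : ℝ)) * v S := by
    intro R _
    rw [← Finset.sum_mul, ← Finset.mul_sum, ← upSum, ← upSum, ← upSum_mul_div hw hvw R]
    rcases eq_or_ne (upSum k w R) 0 with h | h
    · simp [h]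
    · field_simp
  rw [h1, ← sum_powersetCard_sum_filter, Finset.sum_congr rfl h2, sum_powersetCard_sum_filter]
  refine Finset.sum_congr rfl fun S hS => ?_
  rw [Finset.sum_const, card_powersetCard, mem_powersetCard_univ.1 hS, Nat.choose_symm hk,
    Nat.choose_one_right, nsmul_eq_mul]
  field_simp

theorem sum_abs_pushWeight_sub_le {α : Type*} [Fintype α] [DecidableEq α] {k : ℕ}
    {w u v : Finset α → ℝ} (hk : 1 ≤ k) (hw : ∀ S : Finset α, S.card = k → 0 ≤ w S)
    (huw : ∀ S : Finset α, S.card = k → w S = 0 → u S = 0)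
    (hvw : ∀ S : Finset α, S.card = k → w S = 0 → v S = 0) :
    ∑ S ∈ powersetCard k univ, |pushWeight k w u S - pushWeight k w v S| ≤
      ∑ S ∈ powersetCard k univ, |u S - v S| := by
  rw [← sum_pushWeight hk hw (v := fun S => |u S - v S|) fun S hS h => by
    simp [huw S hS h, hvw S hS h]]
  refine Finset.sum_le_sum fun S' hS' => ?_
  simp only [pushWeight, ← Finset.sum_sub_distrib, ← sub_mul]
  refine (Finset.abs_sum_le_sum_abs _ _).trans (le_of_eq ?_)
  refine Finset.sum_congr rfl fun S _ => ?_
  rw [abs_mul, abs_of_nonneg (downUp_nonneg hw S (mem_powersetCard_univ.1 hS'))]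

/-- The down-up walk contracts relative entropy by the factor `1 - 1 / k`. -/
theorem relEnt_pushWeight_le {α : Type*} [Fintype α] [DecidableEq α] {k : ℕ}
    {w v : Finset α → ℝ} (hk : 1 ≤ k) (hw : ∀ S : Finset α, S.card = k → 0 ≤ w S)
    (hT : LinkTangentBound k w) (hv : ∀ S : Finset α, S.card = k → 0 ≤ v S)
    (hvw : ∀ S : Finset α, S.card = k → w S = 0 → v S = 0)
    (hsum : ∑ S ∈ powersetCard k (univ : Finset α), v S =
      ∑ S ∈ powersetCard k (univ : Finset α), w S) :
    relEnt k (pushWeight k w v) w ≤ (1 - 1 / (k : ℝ)) * relEnt k v w := by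
  have hkpos : (0 : ℝ) < k := by exact_mod_cast hk
  set g : Finset α → ℝ := fun R => upSum k v R / upSum k w R with hg
  have hg0 : ∀ R, 0 ≤ g R := fun R => div_nonneg (upSum_nonneg hv R) (upSum_nonneg hw R)
  have h1 : ∀ S ∈ powersetCard k (univ : Finset α),
      pushWeight k w v S * Real.log (pushWeight k w v S / w S) ≤
        ∑ R ∈ powersetCard (k - 1) S, w S * ((1 / (k : ℝ)) * (g R * Real.log (g R))) := by
    intro S hS
    rw [mem_powersetCard_univ] at hS
    rw [pushWeight_eq hk hvw S, ← Finset.mul_sum (powersetCard (k - 1) S)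
      (fun R => (1 / (k : ℝ)) * (g R * Real.log (g R))) (w S)]
    rcases (hw S hS).eq_or_lt with h0 | h0
    · simp [← h0]
    rw [mul_div_cancel_left₀ _ h0.ne', mul_assoc]
    refine mul_le_mul_of_nonneg_left ?_ h0.le
    have := Real.convexOn_mul_log.map_sum_le (t := powersetCard (k - 1) S)
      (w := fun _ => 1 / (k : ℝ)) (p := g) (fun _ _ => by positivity)
      (by
        rw [Finset.sum_const, card_powersetCard, hS, Nat.choose_symm hk, Nat.choose_one_right,
          nsmul_eq_mul]
        field_simp) (fun R _ => hg0 R)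
    simpa only [smul_eq_mul] using this
  have h2 : relEnt k (pushWeight k w v) w ≤ 1 / (k : ℝ) * levelEnt k v w (k - 1) := by
    refine (Finset.sum_le_sum h1).trans (le_of_eq ?_)
    rw [← sum_powersetCard_sum_filter, levelEnt, Finset.mul_sum]
    refine Finset.sum_congr rfl fun R _ => ?_
    rw [← Finset.sum_mul, ← upSum]
    conv_rhs => rw [← upSum_mul_div hw hvw R]
    rw [upSum_mul_div hw hvw R]
    have := upSum_mul_div hw hvw R
    simp only [hg]
    linear_combination (1 / (k : ℝ) * Real.log (upSum k v R / upSum k w R)) * this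
  refine h2.trans ((mul_le_mul_of_nonneg_left (levelEnt_pred_le hk hw hT hv hvw hsum)
    (by positivity)).trans (le_of_eq ?_))
  field_simp

/-- A form of Pinsker's inequality. -/
theorem sq_sum_abs_sub_le_relEnt {α : Type*} [Fintype α] {k : ℕ} {w v : Finset α → ℝ}
    (hw : ∀ S : Finset α, S.card = k → 0 ≤ w S) (hv : ∀ S : Finset α, S.card = k → 0 ≤ v S)
    (hvw : ∀ S : Finset α, S.card = k → w S = 0 → v S = 0)
    (hw1 : ∑ S ∈ powersetCard k (univ : Finset α), w S = 1)
    (hv1 : ∑ S ∈ powersetCard k (univ : Finset α), v S = 1) :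
    (∑ S ∈ powersetCard k (univ : Finset α), |v S - w S|) ^ 2 ≤ 4 * relEnt k v w := by
  have h1 : ∀ S ∈ powersetCard k (univ : Finset α),
      |v S - w S| = |√(v S) - √(w S)| * (√(v S) + √(w S)) := by
    intro S hS
    rw [mem_powersetCard_univ] at hS
    rw [← abs_of_nonneg (add_nonneg (Real.sqrt_nonneg (v S)) (Real.sqrt_nonneg (w S))), ← abs_mul]
    congr 1
    nlinarith [Real.mul_self_sqrt (hv S hS), Real.mul_self_sqrt (hw S hS)]
  have h2 : ∑ S ∈ powersetCard k (univ : Finset α), |√(v S) - √(w S)| ^ 2 ≤ relEnt k v w := by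
    have h3 : ∀ S ∈ powersetCard k (univ : Finset α), |√(v S) - √(w S)| ^ 2 ≤
        v S * Real.log (v S / w S) - v S + w S := by
      intro S hS
      rw [mem_powersetCard_univ] at hS
      rw [sq_abs]
      rcases (hv S hS).eq_or_lt with h0 | h0
      · rw [← h0]
        simp [Real.sq_sqrt (hw S hS)]
      have hwS : 0 < w S := (hw S hS).lt_of_ne fun h => h0.ne' (hvw S hS h.symm)
      have hx := Real.sqrt_pos.2 h0
      have hy := Real.sqrt_pos.2 hwS
      have hlog := Real.one_sub_inv_le_log_of_pos (div_pos hx hy)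
      have h4 : Real.log (v S / w S) = 2 * Real.log (√(v S) / √(w S)) := by
        rw [← Real.sqrt_div h0.le, Real.log_sqrt (div_pos h0 hwS).le]
        ring
      have h5 : v S * (1 - (√(v S) / √(w S))⁻¹) = v S - √(v S) * √(w S) := by
        rw [inv_div, mul_sub, mul_one]
        congr 1
        rw [← mul_div_assoc, div_eq_iff hx.ne']
        nlinarith [Real.mul_self_sqrt h0.le]
      have h6 := mul_le_mul_of_nonneg_left hlog h0.le
      rw [h5] at h6
      rw [h4]
      nlinarith [Real.sq_sqrt h0.le, Real.sq_sqrt hwS.le]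
    refine (Finset.sum_le_sum h3).trans (le_of_eq ?_)
    rw [Finset.sum_add_distrib, Finset.sum_sub_distrib, hw1, hv1, relEnt]
    ring
  have h3 : ∑ S ∈ powersetCard k (univ : Finset α), (√(v S) + √(w S)) ^ 2 ≤ 4 := by
    have h4 : ∀ S ∈ powersetCard k (univ : Finset α), (√(v S) + √(w S)) ^ 2 ≤
        2 * v S + 2 * w S := by
      intro S hS
      rw [mem_powersetCard_univ] at hS
      nlinarith [Real.sq_sqrt (hv S hS), Real.sq_sqrt (hw S hS), sq_nonneg (√(v S) - √(w S))]
    refine (Finset.sum_le_sum h4).trans (le_of_eq ?_)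
    rw [Finset.sum_add_distrib, ← Finset.mul_sum, ← Finset.mul_sum, hw1, hv1]
    norm_num
  rw [Finset.sum_congr rfl h1]
  refine (Finset.sum_mul_sq_le_sq_mul_sq _ _ _).trans ?_
  have h0 : 0 ≤ ∑ S ∈ powersetCard k (univ : Finset α), |√(v S) - √(w S)| ^ 2 :=
    Finset.sum_nonneg fun _ _ => by positivity
  nlinarith [mul_le_mul_of_nonneg_left h3 h0]

/-- Weights supported on the `k`-sets in the support of `w` with the same total mass `1`. -/
structure IsDensity {α : Type*} [Fintype α] (k : ℕ) (w v : Finset α → ℝ) : Prop where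
  nonneg : ∀ S : Finset α, S.card = k → 0 ≤ v S
  eq_zero : ∀ S : Finset α, S.card = k → w S = 0 → v S = 0
  sum_eq_one : ∑ S ∈ powersetCard k (univ : Finset α), v S = 1

theorem IsDensity.pushWeight {α : Type*} [Fintype α] [DecidableEq α] {k : ℕ} {w v : Finset α → ℝ}
    (hk : 1 ≤ k) (hw : IsDensity k w w) (hv : IsDensity k w v) :
    IsDensity k w (pushWeight k w v) where
  nonneg _ hS := pushWeight_nonneg hw.nonneg hv.nonneg hS
  eq_zero S _ h := by rw [pushWeight_eq hk hv.eq_zero S, h, zero_mul]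
  sum_eq_one := by rw [sum_pushWeight hk hw.nonneg hv.eq_zero, hv.sum_eq_one]

theorem IsDensity.iterate {α : Type*} [Fintype α] [DecidableEq α] {k : ℕ} {w v : Finset α → ℝ}
    (hk : 1 ≤ k) (hw : IsDensity k w w) (hv : IsDensity k w v) (t : ℕ) :
    IsDensity k w ((_root_.pushWeight k w)^[t] v) := by
  induction t with
  | zero => exact hv
  | succ t ih =>
    rw [Function.iterate_succ_apply']
    exact IsDensity.pushWeight hk hw ih

theorem sum_abs_iterate_pushWeight_sub_le {α : Type*} [Fintype α] [DecidableEq α] {k : ℕ}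
    {w u v : Finset α → ℝ} (hk : 1 ≤ k) (hw : IsDensity k w w) (hu : IsDensity k w u)
    (hv : IsDensity k w v) (t : ℕ) :
    ∑ S ∈ powersetCard k univ, |(pushWeight k w)^[t] u S - (pushWeight k w)^[t] v S| ≤
      ∑ S ∈ powersetCard k univ, |u S - v S| := by
  induction t with
  | zero => exact le_rfl
  | succ t ih =>
    rw [Function.iterate_succ_apply', Function.iterate_succ_apply']
    exact (sum_abs_pushWeight_sub_le hk hw.nonneg (IsDensity.iterate hk hw hu t).eq_zero
      (IsDensity.iterate hk hw hv t).eq_zero).trans ih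

theorem relEnt_iterate_pushWeight_le {α : Type*} [Fintype α] [DecidableEq α] {k : ℕ}
    {w v : Finset α → ℝ} (hk : 1 ≤ k) (hw : IsDensity k w w) (hT : LinkTangentBound k w)
    (hv : IsDensity k w v) (t : ℕ) :
    relEnt k ((pushWeight k w)^[t] v) w ≤ (1 - 1 / (k : ℝ)) ^ t * relEnt k v w := by
  have hk1 : 0 ≤ 1 - 1 / (k : ℝ) := by
    have : (1 : ℝ) ≤ k := by exact_mod_cast hk
    rw [sub_nonneg, div_le_one (by linarith)]
    exact this
  induction t with
  | zero => simp
  | succ t ih =>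
    have hd := IsDensity.iterate hk hw hv t
    rw [Function.iterate_succ_apply', pow_succ', mul_assoc]
    exact (relEnt_pushWeight_le hk hw.nonneg hT hd.nonneg hd.eq_zero
      (hd.sum_eq_one.trans hw.sum_eq_one.symm)).trans (mul_le_mul_of_nonneg_left ih hk1)

theorem isDensity_walkDist {α : Type*} [Fintype α] [DecidableEq α] {k : ℕ} {w : Finset α → ℝ}
    (hk : 1 ≤ k) (hw : IsDensity k w w) {S₀ : Finset α} (hS₀ : TrackState k w S₀ ∅) (t : ℕ) :
    IsDensity k w (walkDist univ k w S₀ t) := by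
  have h0 : IsDensity k w (walkDist univ k w S₀ 0) := by
    refine ⟨fun S _ => ?_, fun S _ h => ?_, ?_⟩
    · unfold walkDist
      split_ifs <;> norm_num
    · exact if_neg fun (h' : S = S₀) => hS₀.2.1.ne' (h' ▸ h)
    · simp [walkDist, hS₀.1]
  have h1 := IsDensity.iterate hk hw h0 t
  rwa [← walkDist_add, zero_add] at h1

/-- Up to total mass `(1 - 1 / k) ^ t * k`, the walk is dominated by a multiple of `w` after
`t` steps. -/
theorem exists_isDensity_le_mul {α : Type*} [Fintype α] [DecidableEq α] {k : ℕ}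
    {w : Finset α → ℝ} (hk : 1 ≤ k) (hw : IsDensity k w w) (hT : LinkTangentBound k w)
    {S₀ : Finset α} (hS₀ : TrackState k w S₀ ∅) (t : ℕ) :
    ∃ v, IsDensity k w v ∧
      (∀ S : Finset α, S.card = k → v S ≤ ((k * Real.exp 2 ^ k) ^ k + 1) * w S) ∧
      ∑ S ∈ powersetCard k univ, |walkDist univ k w S₀ t S - v S| ≤
        2 * ((1 - 1 / (k : ℝ)) ^ t * k) := by
  set W := walkDist univ k w S₀ t with hWdef
  have hW : IsDensity k w W := isDensity_walkDist hk hw hS₀ t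
  set full : Finset α → Finset α → Finset α → ℝ := fun T S F => if S = T ∧ F = S then 1 else 0
    with hfull
  set a : Finset α → ℝ := fun T => (trackStep k w ^ t) (full T) S₀ ∅ with ha
  have hWT : ∀ T : Finset α, T.card = k →
      W T = (trackStep k w ^ t) (fun S _ => if S = T then 1 else 0) S₀ ∅ := by
    intro T hTk
    rw [← sum_walkDist_mul hw.nonneg hS₀]
    simp [hTk, hWdef]
  have ha0 : ∀ T, 0 ≤ a T := fun T => trackStep_pow_nonneg hw.nonneg t
    (fun S F => by simp only [hfull]; split_ifs <;> norm_num) hS₀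
  have haW : ∀ T : Finset α, T.card = k → a T ≤ W T := by
    intro T hTk
    rw [hWT T hTk]
    refine trackStep_pow_mono hw.nonneg t (fun S F _ => ?_) hS₀
    by_cases h1 : S = T <;> by_cases h2 : F = S <;> simp [hfull, h1, h2]
    split_ifs <;> norm_num
  have haw : ∀ T : Finset α, T.card = k → a T ≤ (k * Real.exp 2 ^ k) ^ k * w T := by
    intro T hTk
    have h1 := trackStep_pow_allAdded_le hk hw.nonneg hT hw.sum_eq_one hS₀ t T hTk.le
    rw [hTk, upSum_self w hTk] at h1
    refine le_trans (trackStep_pow_mono hw.nonneg t (fun S F _ => ?_) hS₀) h1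
    by_cases h : S = T ∧ F = S
    · simp [hfull, allAdded, h.1, h.2]
    · simp only [hfull, if_neg h]
      exact allAdded_nonneg _ _ _
  set d := ∑ S ∈ powersetCard k univ, (W S - a S) with hd
  have hd0 : 0 ≤ d := Finset.sum_nonneg fun S hS =>
    sub_nonneg.2 (haW S (mem_powersetCard_univ.1 hS))
  have hsum : ∑ S ∈ powersetCard k univ, a S = 1 - d := by
    rw [hd, Finset.sum_sub_distrib, hW.sum_eq_one]
    ring
  have hd1 : d ≤ 1 := by
    have := Finset.sum_nonneg fun S (_ : S ∈ powersetCard k (univ : Finset α)) => ha0 S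
    linarith
  have hdle : d ≤ (1 - 1 / (k : ℝ)) ^ t * k := by
    refine le_trans ?_ (trackStep_pow_card_sdiff_le hk hw.nonneg hS₀ t)
    have h1 : d = (trackStep k w ^ t) (∑ T ∈ powersetCard k univ,
        ((fun S _ => if S = T then 1 else 0) - full T)) S₀ ∅ := by
      simp only [map_sum, map_sub, Finset.sum_apply, Pi.sub_apply]
      exact Finset.sum_congr rfl fun T hTk => by rw [hWT T (mem_powersetCard_univ.1 hTk)]
    rw [h1]
    refine trackStep_pow_mono hw.nonneg t (fun S F hS => ?_) hS₀
    have h2 : ∑ T ∈ powersetCard k univ, (if S = T ∧ F = S then (1 : ℝ) else 0) =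
        if F = S then 1 else 0 := by
      by_cases h : F = S <;> simp [h, hS.1]
    simp only [Finset.sum_apply, Pi.sub_apply, Finset.sum_sub_distrib, hfull, h2]
    simp only [Finset.sum_ite_eq, mem_powersetCard_univ, hS.1, if_true]
    split_ifs with h
    · simp
    · have h3 : 1 ≤ (S \ F).card := card_pos.2
        (sdiff_nonempty.2 fun h' => h (hS.2.2.antisymm h'))
      rw [sub_zero]
      exact_mod_cast h3
  refine ⟨fun S => a S + d * w S, ⟨fun S hS => ?_, fun S hS h => ?_, ?_⟩, fun S hS => ?_, ?_⟩
  · exact add_nonneg (ha0 S) (mul_nonneg hd0 (hw.nonneg S hS))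
  · have := haW S hS
    rw [hW.eq_zero S hS h] at this
    rw [h, mul_zero, add_zero]
    exact this.antisymm (ha0 S)
  · rw [Finset.sum_add_distrib, ← Finset.mul_sum, hw.sum_eq_one, hsum]
    ring
  · rw [add_mul]
    exact add_le_add (haw S hS) (mul_le_mul_of_nonneg_right hd1 (hw.nonneg S hS))
  · calc _ ≤ ∑ S ∈ powersetCard k univ, ((W S - a S) + d * w S) := by
          refine Finset.sum_le_sum fun S hS => ?_
          rw [mem_powersetCard_univ] at hS
          have h1 := haW S hS
          have h2 := mul_nonneg hd0 (hw.nonneg S hS)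
          rw [abs_le]
          constructor <;> linarith
      _ = 2 * d := by
          rw [Finset.sum_add_distrib, ← Finset.mul_sum, hw.sum_eq_one, ← hd]
          ring
      _ ≤ _ := by linarith

theorem relEnt_le_log {α : Type*} [Fintype α] {k : ℕ} {w v : Finset α → ℝ} {c : ℝ}
    (hw : ∀ S : Finset α, S.card = k → 0 ≤ w S) (hv : IsDensity k w v)
    (hc : ∀ S : Finset α, S.card = k → v S ≤ c * w S) : relEnt k v w ≤ Real.log c := by
  rw [relEnt, ← one_mul (Real.log c), ← hv.sum_eq_one, Finset.sum_mul]
  refine Finset.sum_le_sum fun S hS => ?_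
  rw [mem_powersetCard_univ] at hS
  rcases (hv.nonneg S hS).eq_or_lt with h0 | h0
  · simp [← h0]
  have hwS : 0 < w S := (hw S hS).lt_of_ne fun h => h0.ne' (hv.eq_zero S hS h.symm)
  exact mul_le_mul_of_nonneg_left
    (Real.log_le_log (div_pos h0 hwS) ((div_le_iff₀ hwS).2 (hc S hS))) h0.le

theorem log_warm_le {k : ℕ} (hk : 1 ≤ k) :
    Real.log ((k * Real.exp 2 ^ k) ^ k + 1) ≤ 4 * (k : ℝ) ^ 2 := by
  have hk1 : (1 : ℝ) ≤ k := by exact_mod_cast hk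
  have h1 : (k : ℝ) ≤ Real.exp k := by linarith [Real.add_one_le_exp (k : ℝ)]
  have h2 : (k * Real.exp 2 ^ k) ^ k ≤ Real.exp (3 * (k : ℝ) ^ 2) := by
    calc (k * Real.exp 2 ^ k) ^ k ≤ (Real.exp k * Real.exp 2 ^ k) ^ k := by gcongr
      _ = _ := by
        rw [← Real.exp_nat_mul, ← Real.exp_add, ← Real.exp_nat_mul]
        congr 1
        ring
  have h3 : (1 : ℝ) ≤ Real.exp (3 * (k : ℝ) ^ 2) := Real.one_le_exp (by positivity)
  have h4 : (2 : ℝ) ≤ Real.exp ((k : ℝ) ^ 2) := by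
    nlinarith [Real.add_one_le_exp ((k : ℝ) ^ 2)]
  rw [Real.log_le_iff_le_exp (by positivity)]
  calc _ ≤ 2 * Real.exp (3 * (k : ℝ) ^ 2) := by linarith
    _ ≤ Real.exp ((k : ℝ) ^ 2) * Real.exp (3 * (k : ℝ) ^ 2) := by gcongr
    _ = _ := by
      rw [← Real.exp_add]
      congr 1
      ring

/-- A quantitative mixing estimate for the down-up walk. -/
theorem tvDist_walkDist_le {α : Type*} [Fintype α] [DecidableEq α] {k : ℕ}
    {w : Finset α → ℝ} (hk : 1 ≤ k) (hw : IsDensity k w w) (hT : LinkTangentBound k w)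
    {S₀ : Finset α} (hS₀ : TrackState k w S₀ ∅) (s t : ℕ) :
    tvDist univ k (walkDist univ k w S₀ (s + t)) w ≤
      (1 - 1 / (k : ℝ)) ^ s * k + √((1 - 1 / (k : ℝ)) ^ t * (4 * (k : ℝ) ^ 2)) := by
  have hk1 : 0 ≤ 1 - 1 / (k : ℝ) := by
    have : (1 : ℝ) ≤ k := by exact_mod_cast hk
    rw [sub_nonneg, div_le_one (by linarith)]
    exact this
  obtain ⟨v, hv, hvle, hvW⟩ := exists_isDensity_le_mul hk hw hT hS₀ s
  have h1 := sum_abs_iterate_pushWeight_sub_le hk hw (isDensity_walkDist hk hw hS₀ s) hv t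
  rw [← walkDist_add] at h1
  have hd := IsDensity.iterate hk hw hv t
  have h2 := sq_sum_abs_sub_le_relEnt hw.nonneg hd.nonneg hd.eq_zero hw.sum_eq_one hd.sum_eq_one
  have h3 : relEnt k ((pushWeight k w)^[t] v) w ≤ (1 - 1 / (k : ℝ)) ^ t * (4 * (k : ℝ) ^ 2) :=
    (relEnt_iterate_pushWeight_le hk hw hT hv t).trans (mul_le_mul_of_nonneg_left
      ((relEnt_le_log hw.nonneg hv hvle).trans (log_warm_le hk)) (pow_nonneg hk1 t))
  have h4 : (1 / 2) * ∑ S ∈ powersetCard k univ, |(pushWeight k w)^[t] v S - w S| ≤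
      √((1 - 1 / (k : ℝ)) ^ t * (4 * (k : ℝ) ^ 2)) := by
    refine Real.le_sqrt_of_sq_le ?_
    linarith [mul_pow (1 / 2 : ℝ)
      (∑ S ∈ powersetCard k univ, |(pushWeight k w)^[t] v S - w S|) 2]
  have h5 : ∑ S ∈ powersetCard k univ, |walkDist univ k w S₀ (s + t) S - w S| ≤
      ∑ S ∈ powersetCard k univ, |walkDist univ k w S₀ (s + t) S - (pushWeight k w)^[t] v S| +
      ∑ S ∈ powersetCard k univ, |(pushWeight k w)^[t] v S - w S| := by
    rw [← Finset.sum_add_distrib]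
    exact Finset.sum_le_sum fun S _ => abs_sub_le _ _ _
  rw [tvDist]
  linarith

theorem one_sub_inv_pow_le {k t : ℕ} (hk : 1 ≤ k) {ε : ℝ} (hε : 0 < ε)
    (ht : 3 * k * (Real.log k + Real.log (1 / ε) + 1) ≤ t) :
    (1 - 1 / (k : ℝ)) ^ t ≤ (ε / k) ^ 3 / 16 := by
  have hkpos : (0 : ℝ) < k := by exact_mod_cast hk
  have hk1 : 0 ≤ 1 - 1 / (k : ℝ) := by
    rw [sub_nonneg, div_le_one hkpos]
    exact_mod_cast hk
  have h1 : Real.exp (-(3 * (Real.log k + Real.log (1 / ε)))) = (ε / k) ^ 3 := by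
    rw [← Real.exp_log (div_pos hε hkpos), ← Real.exp_nat_mul, Real.log_div hε.ne' hkpos.ne',
      one_div, Real.log_inv]
    congr 1
    push_cast
    ring
  have h2 : (16 : ℝ) ≤ Real.exp 3 := by
    have h3 := Real.exp_one_gt_d9
    have h4 : Real.exp 3 = Real.exp 1 ^ 3 := by
      rw [← Real.exp_nat_mul]
      norm_num
    rw [h4]
    calc (16 : ℝ) ≤ 2.7 ^ 3 := by norm_num
      _ ≤ _ := by gcongr; linarith
  calc (1 - 1 / (k : ℝ)) ^ t ≤ Real.exp (-(1 / k)) ^ t := by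
        gcongr
        linarith [Real.add_one_le_exp (-(1 / (k : ℝ)))]
    _ = Real.exp (-(t / k)) := by
        rw [← Real.exp_nat_mul]
        congr 1
        ring
    _ ≤ Real.exp (-(3 * (Real.log k + Real.log (1 / ε))) - 3) := by
        refine Real.exp_le_exp.2 ?_
        have : 3 * (Real.log k + Real.log (1 / ε) + 1) ≤ t / k := by
          rw [le_div_iff₀ hkpos]
          linarith
        linarith
    _ = (ε / k) ^ 3 / Real.exp 3 := by rw [Real.exp_sub, h1]
    _ ≤ _ := by gcongr

theorem mixing_error_le {k s t : ℕ} (hk : 1 ≤ k) {ε : ℝ} (hε : 0 < ε) (hε1 : ε < 1)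
    (hs : 3 * k * (Real.log k + Real.log (1 / ε) + 1) ≤ s)
    (ht : 3 * k * (Real.log k + Real.log (1 / ε) + 1) ≤ t) :
    (1 - 1 / (k : ℝ)) ^ s * k + √((1 - 1 / (k : ℝ)) ^ t * (4 * (k : ℝ) ^ 2)) ≤ ε := by
  have hk1 : (1 : ℝ) ≤ k := by exact_mod_cast hk
  have hkpos : (0 : ℝ) < k := by linarith
  have hx : 0 < ε / k := div_pos hε hkpos
  have hx1 : ε / k ≤ 1 := by
    rw [div_le_one hkpos]
    linarith
  have hxk : ε / k * k = ε := div_mul_cancel₀ _ hkpos.ne'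
  have h3 : (ε / k) ^ 3 ≤ (ε / k) ^ 2 := pow_le_pow_of_le_one hx.le hx1 (by norm_num)
  have h2 : (ε / k) ^ 3 ≤ ε / k := pow_le_of_le_one hx.le hx1 (by norm_num)
  have h4 : (1 - 1 / (k : ℝ)) ^ s * k ≤ ε / 2 := by
    calc _ ≤ (ε / k) / 16 * k := by
          gcongr
          exact (one_sub_inv_pow_le hk hε hs).trans (by linarith)
      _ ≤ ε / 2 := by linarith
  have h5 : √((1 - 1 / (k : ℝ)) ^ t * (4 * (k : ℝ) ^ 2)) ≤ ε / 2 := by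
    refine Real.sqrt_le_iff.2 ⟨by linarith, ?_⟩
    calc _ ≤ (ε / k) ^ 2 / 16 * (4 * (k : ℝ) ^ 2) := by
          gcongr
          exact (one_sub_inv_pow_le hk hε ht).trans (by linarith)
      _ = (ε / k * k) ^ 2 / 4 := by ring
      _ = _ := by rw [hxk]; ring
  linarith

theorem upSum_statDist {α : Type*} [Fintype α] [DecidableEq α] (k : ℕ) (μ : Finset α → ℝ)
    (R : Finset α) :
    upSum k (statDist univ k μ) R = upSum k μ R / ∑ S ∈ powersetCard k univ, μ S := by
  simp only [upSum, statDist, Finset.sum_div]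

theorem linkTangentBound_statDist {α : Type*} [Fintype α] [DecidableEq α] {k : ℕ}
    {μ : Finset α → ℝ} (hT : LinkTangentBound k μ)
    (hZ : 0 < ∑ S ∈ powersetCard k (univ : Finset α), μ S) :
    LinkTangentBound k (statDist univ k μ) := by
  intro R z hz hR
  have h1 : linkPoly k (statDist univ k μ) R z =
      linkPoly k μ R z / ∑ S ∈ powersetCard k univ, μ S := by
    simp only [linkPoly, statDist, Finset.sum_div]
    exact Finset.sum_congr rfl fun S _ => by ring
  simp only [upSum_statDist, div_div_div_cancel_right₀ hZ.ne'] at hR ⊢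
  rw [h1, div_mul_eq_mul_div]
  exact div_le_div_of_nonneg_right (hT R z hz ((div_pos_iff_of_pos_right hZ).1 hR)) hZ.le

theorem downUp_statDist {α : Type*} [Fintype α] [DecidableEq α] {k : ℕ} {μ : Finset α → ℝ}
    (hZ : 0 < ∑ S ∈ powersetCard k (univ : Finset α), μ S) :
    downUp univ k (statDist univ k μ) = downUp univ k μ := by
  ext S S'
  simp only [downUp, statDist, ← Finset.sum_div, div_div_div_cancel_right₀ hZ.ne',
    div_eq_zero_iff, hZ.ne', or_false]

theorem walkDist_statDist {α : Type*} [Fintype α] [DecidableEq α] {k : ℕ} {μ : Finset α → ℝ}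
    (hZ : 0 < ∑ S ∈ powersetCard k (univ : Finset α), μ S) (S₀ : Finset α) (t : ℕ) :
    walkDist univ k (statDist univ k μ) S₀ t = walkDist univ k μ S₀ t := by
  induction t with
  | zero => rfl
  | succ t ih => simp only [walkDist, ih, downUp_statDist hZ]

theorem isDensity_statDist {α : Type*} [Fintype α] [DecidableEq α] {k : ℕ} {μ : Finset α → ℝ}
    (hμ : ∀ S : Finset α, S.card = k → 0 ≤ μ S)
    (hZ : 0 < ∑ S ∈ powersetCard k (univ : Finset α), μ S) :
    IsDensity k (statDist univ k μ) (statDist univ k μ) where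
  nonneg S hS := div_nonneg (hμ S hS) hZ.le
  eq_zero _ _ h := h
  sum_eq_one := by
    simp only [statDist, ← Finset.sum_div]
    exact div_self hZ.ne'

/-- **Theorem 1 (main):** the down-up walk for a distribution with a log-concave generating
polynomial mixes in time `O(k log(k/ε))`, independently of `n` and the starting point. -/
theorem down_up_walk_mixing :
    ∃ C : ℝ, 0 < C ∧
      ∀ (n k : ℕ), 1 ≤ k → k ≤ n →
        ∀ μ : Finset (Fin n) → ℝ,
          (∀ S : Finset (Fin n), S.card = k → 0 ≤ μ S) →
          (∃ S : Finset (Fin n), S.card = k ∧ μ S ≠ 0) →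
          LogConcaveOn (genPoly n k μ) →
          ∀ S₀ : Finset (Fin n), S₀.card = k → 0 < μ S₀ →
            ∀ ε : ℝ, 0 < ε → ε < 1 →
              ∀ t : ℕ, C * k * (Real.log k + Real.log (1 / ε) + 1) ≤ t →
                tvDist (Finset.univ : Finset (Fin n)) k
                    (walkDist Finset.univ k μ S₀ t) (statDist Finset.univ k μ) ≤ ε := by
  refine ⟨8, by norm_num, ?_⟩
  intro n k hk _ μ hμ _ hg S₀ hS₀ hpos ε hε hε1 t ht
  have hZ : 0 < ∑ S ∈ powersetCard k univ, μ S :=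
    hpos.trans_le (Finset.single_le_sum (f := μ)
      (fun S hS => hμ S (mem_powersetCard_univ.1 hS)) (mem_powersetCard_univ.2 hS₀))
  have hk1 : (1 : ℝ) ≤ k := by exact_mod_cast hk
  have hq : 1 ≤ Real.log k + Real.log (1 / ε) + 1 := by
    linarith [Real.log_nonneg hk1, Real.log_nonneg ((one_le_div hε).2 hε1.le)]
  have hkq : 1 ≤ k * (Real.log k + Real.log (1 / ε) + 1) := one_le_mul_of_one_le_of_one_le hk1 hq
  have hhalf : 3 * k * (Real.log k + Real.log (1 / ε) + 1) ≤ (t / 2 : ℕ) := by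
    have h1 : t ≤ 2 * (t / 2) + 1 := by omega
    have h2 : (t : ℝ) ≤ 2 * (t / 2 : ℕ) + 1 := by exact_mod_cast h1
    linarith
  have hhalf' : ((t / 2 : ℕ) : ℝ) ≤ (t - t / 2 : ℕ) := by
    exact_mod_cast (by omega : t / 2 ≤ t - t / 2)
  have h := tvDist_walkDist_le hk (isDensity_statDist hμ hZ)
    (linkTangentBound_statDist (linkTangentBound_of_logConcave hμ hg) hZ)
    (S₀ := S₀) ⟨hS₀, div_pos hpos hZ, empty_subset _⟩ (t / 2) (t - t / 2)
  rw [walkDist_statDist hZ, Nat.add_sub_cancel' (Nat.div_le_self t 2)] at h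
  exact h.trans (mixing_error_le hk hε hε1 hhalf (hhalf.trans hhalf'))
end

section
/- There exists a universal constant C > 1 such that for all integers 1 ≤ k ≤ n, every nonnegative function μ : 𝒞(n,k) → ℝ≥0 whose generating polynomial g_μ is log-concave satisfies the C^k-approximate exchange property: for every S, T ∈ 𝒞(n,k) and every i ∈ S there exists j ∈ T such that (S∖{i})∪{j} and (T∖{j})∪{i} both have k elements and μ(S)·μ(T) ≤ C^k·μ((S∖{i})∪{j})·μ((T∖{j})∪{i}). -/
open Finset

/-- `μ` satisfies the `α`-approximate exchange property on `k`-element subsets of `{1,…,n}`. -/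
def ApproxExchange (n k : ℕ) (α : ℝ) (μ : Finset (Fin n) → ℝ) : Prop :=
  ∀ S T : Finset (Fin n), S.card = k → T.card = k → ∀ i ∈ S, ∃ j ∈ T,
    ((S \ {i}) ∪ {j}).card = k ∧ ((T \ {j}) ∪ {i}).card = k ∧
    μ S * μ T ≤ α * (μ ((S \ {i}) ∪ {j}) * μ ((T \ {j}) ∪ {i}))

/-- The value at `c` of the monomial of `U` in the generating polynomial. -/
noncomputable def weight {n : ℕ} (μ : Finset (Fin n) → ℝ) (c : Fin n → ℝ)
    (U : Finset (Fin n)) : ℝ :=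
  μ U * ∏ e ∈ U, c e

lemma weight_nonneg {n k : ℕ} {μ : Finset (Fin n) → ℝ} (h0 : ∀ S, S.card = k → 0 ≤ μ S)
    {c : Fin n → ℝ} (hc : ∀ e, 0 ≤ c e) {U : Finset (Fin n)} (hU : U.card = k) :
    0 ≤ weight μ c U :=
  mul_nonneg (h0 U hU) (Finset.prod_nonneg fun e _ => hc e)

/-- Exchanging one element changes a product by the obvious factor. -/
lemma prod_exchange {α : Type*} [DecidableEq α] {U : Finset α} {i j : α} (hi : i ∈ U)
    (hj : j ∉ U) (f : α → ℝ) :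
    (∏ e ∈ (U \ {i}) ∪ {j}, f e) * f i = (∏ e ∈ U, f e) * f j := by
  have hd : Disjoint (U \ {i}) {j} := by
    rw [Finset.disjoint_singleton_right]
    simp [hj]
  rw [Finset.prod_union hd, Finset.prod_singleton, ← Finset.erase_eq,
    ← Finset.mul_prod_erase U f hi]
  ring

lemma card_exchange {α : Type*} [DecidableEq α] {U : Finset α} {i j : α} (hi : i ∈ U)
    (hj : j ∉ U) : ((U \ {i}) ∪ {j}).card = U.card := by
  have hd : Disjoint (U \ {i}) {j} := by
    rw [Finset.disjoint_singleton_right]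
    simp [hj]
  rw [Finset.card_union_of_disjoint hd, ← Finset.erase_eq, Finset.card_erase_of_mem hi,
    Finset.card_singleton]
  have := Finset.card_pos.2 ⟨i, hi⟩
  omega

/-- Log-concavity between the points `c · 1_S` and `c · 1_T`. -/
lemma weight_mul_weight_le {n k : ℕ} {μ : Finset (Fin n) → ℝ}
    (h0 : ∀ S, S.card = k → 0 ≤ μ S) (hlc : LogConcaveOn (genPoly n k μ))
    {c : Fin n → ℝ} (hc : ∀ e, 0 ≤ c e) {S T : Finset (Fin n)} (hS : S.card = k)
    (hT : T.card = k) :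
    4 ^ (S \ T).card * (weight μ c S * weight μ c T) ≤
      (∑ U ∈ powersetCard k univ, weight μ c U) ^ 2 := by
  set d := (S \ T).card with hd
  have hpt : ∀ R : Finset (Fin n), ∀ e, 0 ≤ (if e ∈ R then c e else 0) := by
    intro R e
    split_ifs
    · exact hc e
    · exact le_rfl
  have hval : ∀ R : Finset (Fin n), R.card = k →
      weight μ c R ≤ genPoly n k μ (fun e => if e ∈ R then c e else 0) := by
    intro R hR
    have h1 : weight μ c R = weight μ (fun e => if e ∈ R then c e else 0) R := by
      unfold weight
      congr 1
      exact Finset.prod_congr rfl fun e he => by simp [he]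
    rw [h1]
    exact Finset.single_le_sum (f := weight μ (fun e => if e ∈ R then c e else 0))
      (fun U hU => weight_nonneg h0 (hpt R) (Finset.mem_powersetCard.1 hU).2)
      (Finset.mem_powersetCard.2 ⟨Finset.subset_univ R, hR⟩)
  have hmid := hlc _ _ (hpt S) (hpt T) (1 / 2) (by norm_num) (by norm_num)
  set G := genPoly n k μ fun i =>
    1 / 2 * (if i ∈ S then c i else 0) + (1 - 1 / 2) * (if i ∈ T then c i else 0) with hG
  have hGle : 2 ^ d * G ≤ ∑ U ∈ powersetCard k univ, weight μ c U := by
    rw [hG, genPoly, Finset.mul_sum]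
    refine Finset.sum_le_sum fun U hU => ?_
    have hU' := (Finset.mem_powersetCard.1 hU).2
    have hprod : (2 : ℝ) ^ d * ∏ i ∈ U, (1 / 2 * (if i ∈ S then c i else 0) +
        (1 - 1 / 2) * (if i ∈ T then c i else 0)) ≤ ∏ e ∈ U, c e := by
      have h2 : ∏ i ∈ U, (1 / 2 * (if i ∈ S then c i else 0) +
          (1 - 1 / 2) * (if i ∈ T then c i else 0)) ≤
          ∏ e ∈ U, ((if e ∈ S ∩ T then 1 else 1 / 2) * c e) := by
        refine Finset.prod_le_prod (fun e _ => ?_) (fun e _ => ?_)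
        · have := hpt S e
          have := hpt T e
          linarith
        · have := hc e
          by_cases h1 : e ∈ S <;> by_cases h2 : e ∈ T <;> simp [h1, h2] <;> linarith
      have h3 : ∏ e ∈ U, ((if e ∈ S ∩ T then (1 : ℝ) else 1 / 2)) ≤ (1 / 2) ^ d := by
        rw [Finset.prod_ite, Finset.prod_const_one, one_mul, Finset.prod_const]
        refine pow_le_pow_of_le_one (by norm_num) (by norm_num) ?_
        have e1 : U.filter (fun e => e ∉ S ∩ T) = U \ (S ∩ T) := by
          ext e
          simp
        rw [e1]
        have e2 := Finset.le_card_sdiff (S ∩ T) U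
        have e3 := Finset.card_sdiff_add_card_inter S T
        omega
      rw [Finset.prod_mul_distrib] at h2
      have h4 : 0 ≤ ∏ e ∈ U, c e := Finset.prod_nonneg fun e _ => hc e
      calc _ ≤ (2 : ℝ) ^ d * ((1 / 2) ^ d * ∏ e ∈ U, c e) := by
            refine mul_le_mul_of_nonneg_left (h2.trans ?_) (by positivity)
            exact mul_le_mul_of_nonneg_right h3 h4
        _ = ∏ e ∈ U, c e := by
            rw [← mul_assoc, ← mul_pow]
            norm_num
    have := mul_le_mul_of_nonneg_left hprod (h0 U hU')
    unfold weight
    linarith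
  have hS0 := weight_nonneg h0 hc hS
  have hT0 := weight_nonneg h0 hc hT
  have hgS := hS0.trans (hval S hS)
  have hgT := hT0.trans (hval T hT)
  rw [show (1 : ℝ) - 1 / 2 = 1 / 2 by norm_num, ← Real.mul_rpow hgS hgT,
    ← Real.sqrt_eq_rpow] at hmid
  have hG0 : 0 ≤ G := by
    have := (Real.sqrt_nonneg _).trans hmid
    exact this
  have hprod : weight μ c S * weight μ c T ≤ G ^ 2 := by
    refine (mul_le_mul (hval S hS) (hval T hT) hT0 hgS).trans ?_
    rw [← Real.sqrt_le_left hG0]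
    exact hmid
  calc (4 : ℝ) ^ d * (weight μ c S * weight μ c T) ≤ 4 ^ d * G ^ 2 :=
        mul_le_mul_of_nonneg_left hprod (by positivity)
    _ = (2 ^ d * G) ^ 2 := by
        rw [mul_pow, ← pow_mul, mul_comm d 2, pow_mul]
        norm_num
    _ ≤ _ := pow_le_pow_left₀ (by positivity) hGle 2

/-- Only the sets on the face of the Newton polytope maximizing `p` matter. -/
lemma weight_mul_weight_le_face {n k : ℕ} {μ : Finset (Fin n) → ℝ}
    (h0 : ∀ S, S.card = k → 0 ≤ μ S) (hlc : LogConcaveOn (genPoly n k μ))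
    {c : Fin n → ℝ} (hc : ∀ e, 0 ≤ c e) {S T : Finset (Fin n)} (hS : S.card = k)
    (hT : T.card = k) (p : Fin n → ℝ) {M : ℝ} (hpS : ∑ e ∈ S, p e = M)
    (hpT : ∑ e ∈ T, p e = M) (hp : ∀ U, U.card = k → 0 < μ U → ∑ e ∈ U, p e ≤ M) :
    4 ^ (S \ T).card * (weight μ c S * weight μ c T) ≤
      (∑ U ∈ powersetCard k univ, if ∑ e ∈ U, p e = M then weight μ c U else 0) ^ 2 := by
  have hw : ∀ (x : ℝ) (U : Finset (Fin n)),
      weight μ (fun e => c e * Real.exp (p e * x)) U =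
        weight μ c U * Real.exp ((∑ e ∈ U, p e) * x) := by
    intro x U
    unfold weight
    rw [Finset.prod_mul_distrib, ← Real.exp_sum, Finset.sum_mul, mul_assoc]
  have hx : ∀ x : ℝ, 4 ^ (S \ T).card * (weight μ c S * weight μ c T) ≤
      (∑ U ∈ powersetCard k univ,
        weight μ c U * Real.exp ((∑ e ∈ U, p e - M) * x)) ^ 2 := by
    intro x
    have h1 := weight_mul_weight_le h0 hlc
      (c := fun e => c e * Real.exp (p e * x))
      (fun e => mul_nonneg (hc e) (Real.exp_pos _).le) hS hT
    simp only [hw, hpS, hpT] at h1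
    have h2 : ∑ U ∈ powersetCard k univ, weight μ c U * Real.exp ((∑ e ∈ U, p e) * x) =
        (∑ U ∈ powersetCard k univ,
          weight μ c U * Real.exp ((∑ e ∈ U, p e - M) * x)) * Real.exp (M * x) := by
      rw [Finset.sum_mul]
      refine Finset.sum_congr rfl fun U _ => ?_
      rw [mul_assoc, ← Real.exp_add]
      ring_nf
    rw [h2, mul_pow] at h1
    refine le_of_mul_le_mul_right ?_ (pow_pos (Real.exp_pos (M * x)) 2)
    linarith
  refine ge_of_tendsto' (x := Filter.atTop) ?_ hx
  refine Filter.Tendsto.pow (tendsto_finsetSum _ fun U hU => ?_) 2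
  have hU' := (Finset.mem_powersetCard.1 hU).2
  split_ifs with h
  · simp [h]
  · rcases (h0 U hU').eq_or_lt with hz | hpos
    · simp [weight, ← hz]
    · have hlt : ∑ e ∈ U, p e - M < 0 := sub_neg.2 (lt_of_le_of_ne (hp U hU' hpos) h)
      have : Filter.Tendsto (fun x => Real.exp ((∑ e ∈ U, p e - M) * x)) Filter.atTop
          (nhds 0) :=
        Real.tendsto_exp_atBot.comp (Filter.tendsto_id.const_mul_atTop_of_neg hlt)
      simpa using this.const_mul (weight μ c U)

/-- An edge of the Newton polytope of a log-concave multiaffine polynomial joins sets at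
exchange distance one. -/
lemma exists_ne_of_sum_eq {n k : ℕ} {μ : Finset (Fin n) → ℝ}
    (h0 : ∀ S, S.card = k → 0 ≤ μ S) (hlc : LogConcaveOn (genPoly n k μ))
    {S T : Finset (Fin n)} (hS : S.card = k) (hT : T.card = k) (hμS : 0 < μ S)
    (hμT : 0 < μ T) (hd : 2 ≤ (S \ T).card) (p : Fin n → ℝ)
    (hpST : ∑ e ∈ S, p e = ∑ e ∈ T, p e) :
    ∃ U, U.card = k ∧ 0 < μ U ∧ U ≠ S ∧ U ≠ T ∧ ∑ e ∈ S, p e ≤ ∑ e ∈ U, p e := by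
  by_contra! hcon
  have hcard : (T \ S).card = (S \ T).card := Finset.card_sdiff_comm (hT.trans hS.symm)
  obtain ⟨f, hf⟩ := Finset.card_pos.1 (show 0 < (T \ S).card by omega)
  rw [Finset.mem_sdiff] at hf
  set c : Fin n → ℝ := fun e => if e = f then μ S / μ T else 1 with hcdef
  have hc : ∀ e, 0 ≤ c e := by
    intro e
    simp only [hcdef]
    split_ifs <;> positivity
  have hwS : weight μ c S = μ S := by
    simp [weight, hcdef, Finset.prod_ite_eq', hf.2]
  have hwT : weight μ c T = μ S := by
    simp only [weight, hcdef, Finset.prod_ite_eq', hf.1, if_true]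
    field_simp
  have hface := weight_mul_weight_le_face h0 hlc hc hS hT p rfl hpST.symm (by
    intro U hU hμU
    by_cases h1 : U = S
    · rw [h1]
    · by_cases h2 : U = T
      · rw [h2, hpST]
      · exact (hcon U hU hμU h1 h2).le)
  have hne : S ≠ T := by
    rintro rfl
    exact hf.2 hf.1
  have hsum : (∑ U ∈ powersetCard k univ,
      if ∑ e ∈ U, p e = ∑ e ∈ S, p e then weight μ c U else 0) = μ S + μ S := by
    rw [← Finset.sum_subset (s₁ := {S, T})]
    · rw [Finset.sum_pair hne]
      simp [hpST, hwS, hwT]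
    · intro U hU
      rw [Finset.mem_insert, Finset.mem_singleton] at hU
      rw [Finset.mem_powersetCard]
      rcases hU with rfl | rfl
      · exact ⟨Finset.subset_univ _, hS⟩
      · exact ⟨Finset.subset_univ _, hT⟩
    · intro U hU hU2
      have hU' := (Finset.mem_powersetCard.1 hU).2
      simp only [Finset.mem_insert, Finset.mem_singleton, not_or] at hU2
      split_ifs with h
      · rcases (h0 U hU').eq_or_lt with hz | hpos
        · simp [weight, ← hz]
        · exact absurd h (hcon U hU' hpos hU2.1 hU2.2).ne
      · rfl
  rw [hsum, hwS, hwT] at hface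
  have h16 : (16 : ℝ) ≤ 4 ^ (S \ T).card := by
    calc (16 : ℝ) = 4 ^ 2 := by norm_num
      _ ≤ _ := pow_le_pow_right₀ (by norm_num) hd
  nlinarith [mul_pos hμS hμS]

/-- A linear functional whose maximizers are the sets between `S ∩ T` and `S ∪ T`. -/
noncomputable def intervalFunctional {n : ℕ} (S T : Finset (Fin n)) (e : Fin n) : ℝ :=
  (if e ∈ S ∩ T then 1 else 0) - (if e ∉ S ∪ T then 1 else 0)

lemma sum_intervalFunctional {n : ℕ} (S T U : Finset (Fin n)) :
    ∑ e ∈ U, intervalFunctional S T e =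
      (S ∩ T).card - (((S ∩ T) \ U).card + (U \ (S ∪ T)).card : ℕ) := by
  unfold intervalFunctional
  rw [Finset.sum_sub_distrib, Finset.sum_boole, Finset.sum_boole]
  have h1 : U.filter (fun e => e ∈ S ∩ T) = (S ∩ T) ∩ U := by
    ext e
    simp [and_comm, and_assoc]
  have h2 : U.filter (fun e => e ∉ S ∪ T) = U \ (S ∪ T) := by
    ext e
    simp
  rw [h1, h2]
  have h3 := Finset.card_sdiff_add_card_inter (S ∩ T) U
  rw [← h3]
  push_cast
  ring

lemma sum_intervalFunctional_left {n : ℕ} (S T : Finset (Fin n)) :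
    ∑ e ∈ S, intervalFunctional S T e = (S ∩ T).card := by
  rw [sum_intervalFunctional, Finset.sdiff_eq_empty_iff_subset.2 Finset.inter_subset_left,
    Finset.sdiff_eq_empty_iff_subset.2 Finset.subset_union_left]
  simp

lemma sum_intervalFunctional_right {n : ℕ} (S T : Finset (Fin n)) :
    ∑ e ∈ T, intervalFunctional S T e = (S ∩ T).card := by
  rw [sum_intervalFunctional, Finset.sdiff_eq_empty_iff_subset.2 Finset.inter_subset_right,
    Finset.sdiff_eq_empty_iff_subset.2 Finset.subset_union_right]
  simp

lemma sum_intervalFunctional_le {n : ℕ} (S T U : Finset (Fin n)) :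
    ∑ e ∈ U, intervalFunctional S T e ≤ (S ∩ T).card := by
  rw [sum_intervalFunctional]
  exact sub_le_self _ (Nat.cast_nonneg _)

lemma subset_of_lt_sum_intervalFunctional {n : ℕ} {S T U : Finset (Fin n)}
    (h : ((S ∩ T).card : ℝ) - 1 < ∑ e ∈ U, intervalFunctional S T e) :
    S ∩ T ⊆ U ∧ U ⊆ S ∪ T := by
  rw [sum_intervalFunctional] at h
  have h1 : ((((S ∩ T) \ U).card + (U \ (S ∪ T)).card : ℕ) : ℝ) < 1 := by linarith
  have h2 : ((S ∩ T) \ U).card + (U \ (S ∪ T)).card < 1 := by exact_mod_cast h1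
  constructor
  · rw [← Finset.sdiff_eq_empty_iff_subset, ← Finset.card_eq_zero]
    omega
  · rw [← Finset.sdiff_eq_empty_iff_subset, ← Finset.card_eq_zero]
    omega

lemma exists_between_of_sum_eq {n k : ℕ} {μ : Finset (Fin n) → ℝ}
    (h0 : ∀ S, S.card = k → 0 ≤ μ S) (hlc : LogConcaveOn (genPoly n k μ))
    {S T : Finset (Fin n)} (hS : S.card = k) (hT : T.card = k) (hμS : 0 < μ S)
    (hμT : 0 < μ T) (hd : 2 ≤ (S \ T).card) (q : Fin n → ℝ)
    (hqST : ∑ e ∈ S, q e = ∑ e ∈ T, q e) :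
    ∃ U, U.card = k ∧ 0 < μ U ∧ U ≠ S ∧ U ≠ T ∧ S ∩ T ⊆ U ∧ U ⊆ S ∪ T ∧
      ∑ e ∈ S, q e ≤ ∑ e ∈ U, q e := by
  set B := ∑ e, |q e| with hB
  have hqB : ∀ U : Finset (Fin n), |∑ e ∈ U, q e| ≤ B := fun U =>
    (Finset.abs_sum_le_sum_abs _ _).trans
      (Finset.sum_le_sum_of_subset_of_nonneg (Finset.subset_univ U)
        fun e _ _ => abs_nonneg _)
  have hB0 : 0 ≤ B := Finset.sum_nonneg fun e _ => abs_nonneg _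
  obtain ⟨U, hU, hμU, hUS, hUT, hle⟩ := exists_ne_of_sum_eq h0 hlc hS hT hμS hμT hd
    (fun e => q e + (2 * B + 1) * intervalFunctional S T e) (by
      simp only [Finset.sum_add_distrib, ← Finset.mul_sum, sum_intervalFunctional_left,
        sum_intervalFunctional_right, hqST])
  simp only [Finset.sum_add_distrib, ← Finset.mul_sum, sum_intervalFunctional_left] at hle
  have h1 := abs_le.1 (hqB U)
  have h2 := abs_le.1 (hqB S)
  have hsub : S ∩ T ⊆ U ∧ U ⊆ S ∪ T := by
    apply subset_of_lt_sum_intervalFunctional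
    by_contra! hcon
    nlinarith
  refine ⟨U, hU, hμU, hUS, hUT, hsub.1, hsub.2, ?_⟩
  have := sum_intervalFunctional_le S T U
  nlinarith

/-- The support of `μ` contains a set strictly between `S` and the neighbours of `T`. -/
lemma exists_intermediate {n k : ℕ} {μ : Finset (Fin n) → ℝ}
    (h0 : ∀ S, S.card = k → 0 ≤ μ S) (hlc : LogConcaveOn (genPoly n k μ))
    {S T : Finset (Fin n)} (hS : S.card = k) (hT : T.card = k) (hμS : 0 < μ S)
    (hμT : 0 < μ T) (hd : 3 ≤ (S \ T).card) {i : Fin n} (hiS : i ∈ S) (hiT : i ∉ T) :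
    ∃ U, U.card = k ∧ 0 < μ U ∧ U ≠ S ∧ S ∩ T ⊆ U ∧ U ⊆ S ∪ T ∧ i ∈ U ∧
      2 ≤ (U \ T).card := by
  set q : Fin n → ℝ := fun e =>
    (if e = i then ((S \ T).card : ℝ) else 0) - (if e ∈ S \ T then 1 else 0) with hq
  have hqU : ∀ U : Finset (Fin n), ∑ e ∈ U, q e =
      (if i ∈ U then ((S \ T).card : ℝ) else 0) - (U ∩ (S \ T)).card := by
    intro U
    simp only [hq, Finset.sum_sub_distrib, Finset.sum_ite_eq', Finset.sum_boole]
    rw [Finset.filter_mem_eq_inter]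
  have hqS : ∑ e ∈ S, q e = 0 := by
    rw [hqU, if_pos hiS, Finset.inter_eq_right.2 Finset.sdiff_subset, sub_self]
  have hqT : ∑ e ∈ T, q e = 0 := by
    rw [hqU, if_neg hiT, Finset.inter_sdiff_self]
    simp
  obtain ⟨U, hU, hμU, hUS, hUT, hWU, hUST, hle⟩ := exists_between_of_sum_eq h0 hlc hS hT
    hμS hμT (by omega) q (hqS.trans hqT.symm)
  have hiU : i ∈ U := by
    by_contra hiU
    rw [hqS, hqU, if_neg hiU] at hle
    have h1 : ((U ∩ (S \ T)).card : ℝ) ≤ 0 := by linarith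
    have h2 : (U ∩ (S \ T)).card = 0 := by exact_mod_cast h1.antisymm (Nat.cast_nonneg _)
    rw [Finset.card_eq_zero] at h2
    refine hUT (Finset.eq_of_subset_of_card_le (fun e he => ?_) (by omega))
    have h3 := hUST he
    have h4 : e ∉ U ∩ (S \ T) := by simp [h2]
    grind
  by_cases h2 : 2 ≤ (U \ T).card
  · exact ⟨U, hU, hμU, hUS, hWU, hUST, hiU, h2⟩
  have hUTi : U \ T = {i} := by
    refine (Finset.eq_of_subset_of_card_le ?_ ?_).symm
    · simp [hiU, hiT]
    · rw [Finset.card_singleton]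
      omega
  have hSU : 2 ≤ (S \ U).card := by
    have h3 : S \ U = (S \ T).erase i := by
      ext e
      have := congrArg (e ∈ ·) hUTi
      have := @hWU e
      grind
    rw [h3, Finset.card_erase_of_mem (by simp [hiS, hiT])]
    omega
  obtain ⟨V, hV, hμV, hVS, hVU, hWV, hVSU, -⟩ := exists_between_of_sum_eq h0 hlc hS hU
    hμS hμU hSU 0 (by simp)
  have hiV : i ∈ V := hWV (by simp [hiS, hiU])
  refine ⟨V, hV, hμV, hVS, ?_, ?_, hiV, ?_⟩
  · intro e he
    have := @hWU e he
    exact hWV (by grind)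
  · intro e he
    have := hVSU he
    have := @hUST e
    grind
  · by_contra hlt
    have hVTi : V \ T = {i} := by
      refine (Finset.eq_of_subset_of_card_le ?_ ?_).symm
      · simp [hiV, hiT]
      · rw [Finset.card_singleton]
        omega
    refine hVU (Finset.eq_of_subset_of_card_le (fun e he => ?_) (by omega))
    have := congrArg (e ∈ ·) hVTi
    have := hVSU he
    have := @hWU e
    grind

lemma sum_le_of_subset_six {α : Type*} [DecidableEq α] {f : α → ℝ} {s : Finset α}
    {a b c d x y : α} (hs : s ⊆ {a, b, c, d, x, y}) (ha : 0 ≤ f a) (hb : 0 ≤ f b)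
    (hc : 0 ≤ f c) (hd : 0 ≤ f d) (hx : 0 ≤ f x) (hy : 0 ≤ f y) :
    ∑ u ∈ s, f u ≤ f a + f b + f c + f d + f x + f y := by
  have hins : ∀ (v : α) (r : Finset α), 0 ≤ f v →
      ∑ u ∈ insert v r, f u ≤ f v + ∑ u ∈ r, f u := by
    intro v r hv
    by_cases h : v ∈ r
    · rw [Finset.insert_eq_of_mem h]
      linarith
    · rw [Finset.sum_insert h]
  have h1 := hins a {b, c, d, x, y} ha
  have h2 := hins b {c, d, x, y} hb
  have h3 := hins c {d, x, y} hc
  have h4 := hins d {x, y} hd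
  have h5 := hins x {y} hx
  rw [Finset.sum_singleton] at h5
  have h6 : ∑ u ∈ s, f u ≤ ∑ u ∈ {a, b, c, d, x, y}, f u := by
    refine Finset.sum_le_sum_of_subset_of_nonneg hs fun u hu _ => ?_
    simp only [Finset.mem_insert, Finset.mem_singleton] at hu
    rcases hu with rfl | rfl | rfl | rfl | rfl | rfl <;> assumption
  linarith

lemma eq_of_between_of_card_sdiff_eq_two {α : Type*} [DecidableEq α] {k : ℕ}
    {S T U : Finset α} {i a j l : α} (hS : S.card = k) (hT : T.card = k) (hiS : i ∈ S)
    (hiT : i ∉ T) (hST : (S \ T).erase i = {a}) (hTS : T \ S = {j, l}) (hUk : U.card = k)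
    (hWU : S ∩ T ⊆ U) (hUST : U ⊆ S ∪ T) :
    U = S ∨ U = T ∨ U = (S \ {i}) ∪ {j} ∨ U = (S \ {i}) ∪ {l} ∨ U = (T \ {j}) ∪ {i} ∨
      U = (T \ {l}) ∪ {i} := by
  obtain ⟨hjT, hjS⟩ := Finset.mem_sdiff.1 (show j ∈ T \ S by simp [hTS])
  obtain ⟨hlT, hlS⟩ := Finset.mem_sdiff.1 (show l ∈ T \ S by simp [hTS])
  have key : ∀ R : Finset α, R.card = k → U ⊆ R → U = R := fun R hR h =>
    Finset.eq_of_subset_of_card_le h (by omega)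
  have key' : ∀ R : Finset α, R.card = k → R ⊆ U → U = R := fun R hR h =>
    (Finset.eq_of_subset_of_card_le h (by omega)).symm
  have hS' : ∀ e, e ∈ S ↔ e ∈ S ∩ T ∨ e = i ∨ e = a := by
    intro e
    have := congrArg (e ∈ ·) hST
    grind
  have hT' : ∀ e, e ∈ T ↔ e ∈ S ∩ T ∨ e = j ∨ e = l := by
    intro e
    have := congrArg (e ∈ ·) hTS
    grind
  have c1 := (card_exchange hiS hjS).trans hS
  have c2 := (card_exchange hiS hlS).trans hS
  have c3 := (card_exchange hjT hiT).trans hT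
  have c4 := (card_exchange hlT hiT).trans hT
  have hsubU : ∀ R : Finset α, (∀ e ∈ R, e ∈ S ∩ T ∨ e ∈ U) → R ⊆ U :=
    fun R h e he => (h e he).elim (fun h => hWU h) id
  have hUsub : ∀ e ∈ U, e ∈ S ∩ T ∨ e = i ∨ e = a ∨ e = j ∨ e = l := by
    intro e he
    have := hUST he
    have := hS' e
    have := hT' e
    grind
  by_cases hi : i ∈ U
  · by_cases hja : j ∈ U
    · exact Or.inr (Or.inr (Or.inr (Or.inr (Or.inr
        (key' _ c4 (hsubU _ fun e he => by have := hT' e; grind))))))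
    · by_cases hla : l ∈ U
      · exact Or.inr (Or.inr (Or.inr (Or.inr (Or.inl
          (key' _ c3 (hsubU _ fun e he => by have := hT' e; grind))))))
      · exact Or.inl (key _ hS fun e he => by have := hS' e; have := hUsub e he; grind)
  · by_cases haU : a ∈ U
    · by_cases hja : j ∈ U
      · exact Or.inr (Or.inr (Or.inl
          (key' _ c1 (hsubU _ fun e he => by have := hS' e; grind))))
      · exact Or.inr (Or.inr (Or.inr (Or.inl
          (key _ c2 fun e he => by have := hS' e; have := hUsub e he; grind))))
    · exact Or.inr (Or.inl
        (key _ hT fun e he => by have := hT' e; have := hUsub e he; grind))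

/-- At distance two, the products over all exchanges cannot be too small. -/
lemma not_small_exchange_of_card_sdiff_eq_two {n k : ℕ} {μ : Finset (Fin n) → ℝ}
    (h0 : ∀ S, S.card = k → 0 ≤ μ S) (hlc : LogConcaveOn (genPoly n k μ))
    {S T : Finset (Fin n)} (hS : S.card = k) (hT : T.card = k) (hμS : 0 < μ S)
    (hμT : 0 < μ T) (hd : (S \ T).card = 2) {i : Fin n} (hiS : i ∈ S) (hiT : i ∉ T)
    {t : Fin n → ℝ} (ht : ∀ e, 0 < t e)
    (ha : ∀ j ∈ T \ S, 2 * (μ ((S \ {i}) ∪ {j}) * t j) < μ S)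
    (hb : ∀ j ∈ T \ S, 2 * μ ((T \ {j}) ∪ {i}) < μ T * t j) : False := by
  have hcard : (T \ S).card = 2 := (Finset.card_sdiff_comm (hT.trans hS.symm)).trans hd
  obtain ⟨j, l, hjl, hTS⟩ := Finset.card_eq_two.1 hcard
  obtain ⟨a, hST⟩ : ∃ a, (S \ T).erase i = {a} := by
    rw [← Finset.card_eq_one, Finset.card_erase_of_mem (by simp [hiS, hiT]), hd]
  have hj : j ∈ T \ S := by simp [hTS]
  have hl : l ∈ T \ S := by simp [hTS]
  have ha' : a ∈ (S \ T).erase i := by simp [hST]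
  obtain ⟨hai, haS, haT⟩ : a ≠ i ∧ a ∈ S ∧ a ∉ T := by simpa using ha'
  obtain ⟨hjT, hjS⟩ := Finset.mem_sdiff.1 hj
  obtain ⟨hlT, hlS⟩ := Finset.mem_sdiff.1 hl
  have hr : 0 < t j * t l * μ T / μ S := by
    have := ht j
    have := ht l
    positivity
  set c : Fin n → ℝ := fun e =>
    if e ∈ T \ S then t e else if e = a then t j * t l * μ T / μ S else 1 with hcdef
  have hc : ∀ e, 0 < c e := by
    intro e
    simp only [hcdef]
    split_ifs
    · exact ht e
    · exact hr
    · exact one_pos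
  have hcj : c j = t j := by simp [hcdef, hjT, hjS]
  have hcl : c l = t l := by simp [hcdef, hlT, hlS]
  have hci : c i = 1 := by simp [hcdef, hiT, hai.symm]
  have hcS : ∏ e ∈ S, c e = t j * t l * μ T / μ S := by
    rw [Finset.prod_eq_single_of_mem a haS]
    · simp [hcdef, haT]
    · intro e he hea
      simp [hcdef, he, hea]
  have hcT : ∏ e ∈ T, c e = t j * t l := by
    rw [← Finset.prod_subset (s₁ := T \ S) Finset.sdiff_subset, hTS, Finset.prod_pair hjl,
      hcj, hcl]
    intro e he heS
    have hea : e ≠ a := by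
      rintro rfl
      exact haT he
    simp only [hcdef, if_neg heS, if_neg hea]
  set X := t j * t l * μ T with hX
  have hXpos : 0 < X := by
    have := ht j
    have := ht l
    positivity
  have hwS : weight μ c S = X := by
    rw [weight, hcS]
    field_simp
  have hwT : weight μ c T = X := by
    rw [weight, hcT, hX]
    ring
  have hSx : ∀ x ∈ T \ S, weight μ c ((S \ {i}) ∪ {x}) < X / 2 := by
    intro x hx
    have hxc : c x = t x := by simp only [hcdef, if_pos hx]
    have h1 := prod_exchange hiS (Finset.mem_sdiff.1 hx).2 c
    rw [hci, mul_one, hxc, hcS] at h1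
    rw [weight, h1]
    have h2 : μ ((S \ {i}) ∪ {x}) * (X / μ S * t x) =
        X / μ S * (μ ((S \ {i}) ∪ {x}) * t x) := by ring
    have h3 : X / 2 = X / μ S * (μ S / 2) := by field_simp
    rw [h2, h3]
    have := ha x hx
    exact mul_lt_mul_of_pos_left (by linarith) hr
  have hTx : ∀ x ∈ T \ S, weight μ c ((T \ {x}) ∪ {i}) < X / 2 := by
    intro x hx
    have hxc : c x = t x := by simp only [hcdef, if_pos hx]
    have h1 := prod_exchange (Finset.mem_sdiff.1 hx).1 hiT c
    rw [hci, mul_one, hxc, hcT] at h1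
    have htx := ht x
    rw [weight]
    refine lt_of_mul_lt_mul_right ?_ htx.le
    rw [mul_assoc, h1, hX]
    have h2 := hb x hx
    have h3 : 0 < t j * t l := mul_pos (ht j) (ht l)
    nlinarith
  have hface := weight_mul_weight_le_face h0 hlc (fun e => (hc e).le) hS hT
    (intervalFunctional S T) (sum_intervalFunctional_left S T)
    (sum_intervalFunctional_right S T) (fun U _ _ => sum_intervalFunctional_le S T U)
  rw [← Finset.sum_filter, hwS, hwT, hd] at hface
  have hsub : (powersetCard k univ).filter
      (fun U => ∑ e ∈ U, intervalFunctional S T e = (S ∩ T).card) ⊆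
      {S, T, (S \ {i}) ∪ {j}, (S \ {i}) ∪ {l}, (T \ {j}) ∪ {i}, (T \ {l}) ∪ {i}} := by
    intro U hU
    obtain ⟨hU1, hU2⟩ := Finset.mem_filter.1 hU
    have hUk := (Finset.mem_powersetCard.1 hU1).2
    obtain ⟨hWU, hUST⟩ := subset_of_lt_sum_intervalFunctional (by rw [hU2]; linarith)
    have h6 := eq_of_between_of_card_sdiff_eq_two hS hT hiS hiT hST hTS hUk hWU hUST
    simpa only [Finset.mem_insert, Finset.mem_singleton] using h6
  have hnn : ∀ U : Finset (Fin n), U.card = k → 0 ≤ weight μ c U := fun U hU =>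
    weight_nonneg h0 (fun e => (hc e).le) hU
  have d1 := hnn _ ((card_exchange hiS hjS).trans hS)
  have d2 := hnn _ ((card_exchange hiS hlS).trans hS)
  have d3 := hnn _ ((card_exchange hjT hiT).trans hT)
  have d4 := hnn _ ((card_exchange hlT hiT).trans hT)
  have hlt : ∑ U ∈ (powersetCard k univ).filter
      (fun U => ∑ e ∈ U, intervalFunctional S T e = (S ∩ T).card), weight μ c U < 4 * X := by
    have h6 := sum_le_of_subset_six hsub (hwS.symm ▸ hXpos.le) (hwT.symm ▸ hXpos.le)
      d1 d2 d3 d4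
    have s1 := hSx j hj
    have s2 := hSx l hl
    have s3 := hTx j hj
    have s4 := hTx l hl
    linarith
  have hge : 0 ≤ ∑ U ∈ (powersetCard k univ).filter
      (fun U => ∑ e ∈ U, intervalFunctional S T e = (S ∩ T).card), weight μ c U :=
    Finset.sum_nonneg fun U hU =>
      hnn U (Finset.mem_powersetCard.1 (Finset.mem_filter.1 hU).1).2
  nlinarith

lemma exists_pos_scaling {a b A B r : ℝ} (ha : 0 ≤ a) (hb : 0 ≤ b) (hA : 0 < A) (hB : 0 < B)
    (hr : 0 < r) (h : r ^ 2 * (a * b) < A * B) :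
    ∃ t : ℝ, 0 < t ∧ r * (a * t) < A ∧ r * b < B * t := by
  rcases ha.eq_or_lt with rfl | ha
  · refine ⟨r * b / B + 1, by positivity, by simpa using hA, ?_⟩
    rw [mul_add, mul_div_cancel₀ _ hB.ne']
    linarith
  · have h1 : r * b / B < A / (r * a) := by
      rw [div_lt_div_iff₀ hB (by positivity)]
      nlinarith
    obtain ⟨t, ht1, ht2⟩ := exists_between h1
    have h2 : 0 ≤ r * b / B := by positivity
    rw [div_lt_iff₀ hB] at ht1
    refine ⟨t, ?_, ?_, by linarith⟩
    · by_contra! hneg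
      nlinarith [mul_nonneg hr.le hb]
    · rw [lt_div_iff₀ (by positivity)] at ht2
      linarith

lemma mul_lt_mul_of_two_exchanges {m p q : ℕ} (hpq : p + q = m) {u v u' s τ a b x y : ℝ}
    (hu : 0 < u) (hs : 0 < s) (hτ : 0 < τ) (hv : 0 ≤ v) (hu' : 0 ≤ u') (hy : 0 < y)
    (h1 : u * τ ≤ 4 ^ p * (v * b)) (h2 : s * v ≤ 4 ^ q * (a * u'))
    (ha : 2 ^ m * (a * y) < s) (hb : 2 ^ m * b < τ * x) : u * y < u' * x := by
  have hv : 0 < v := by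
    refine hv.lt_of_ne fun h => ?_
    rw [← h] at h1
    nlinarith [mul_pos hu hτ]
  have hu' : 0 < u' := by
    refine hu'.lt_of_ne fun h => ?_
    rw [← h] at h2
    nlinarith [mul_pos hs hv]
  have hlt1 : 2 ^ m * u < 4 ^ p * (v * x) := by
    refine lt_of_mul_lt_mul_right ?_ hτ.le
    calc 2 ^ m * u * τ = 2 ^ m * (u * τ) := by ring
      _ ≤ 2 ^ m * (4 ^ p * (v * b)) := by gcongr
      _ = 4 ^ p * v * (2 ^ m * b) := by ring
      _ < 4 ^ p * v * (τ * x) := by gcongr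
      _ = _ := by ring
  have hlt2 : 2 ^ m * (v * y) < 4 ^ q * u' := by
    refine lt_of_mul_lt_mul_right ?_ hs.le
    calc 2 ^ m * (v * y) * s = 2 ^ m * y * (s * v) := by ring
      _ ≤ 2 ^ m * y * (4 ^ q * (a * u')) := by gcongr
      _ = 4 ^ q * u' * (2 ^ m * (a * y)) := by ring
      _ < 4 ^ q * u' * s := by gcongr
  have h4 : (4 : ℝ) ^ p * 4 ^ q = 2 ^ m * 2 ^ m := by
    rw [← pow_add, ← mul_pow, hpq]
    norm_num
  have hpos : 0 < (2 : ℝ) ^ m * 2 ^ m * v := by positivity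
  refine lt_of_mul_lt_mul_left ?_ hpos.le
  calc 2 ^ m * 2 ^ m * v * (u * y) = 2 ^ m * u * (2 ^ m * (v * y)) := by ring
    _ < 4 ^ p * (v * x) * (4 ^ q * u') :=
      mul_lt_mul'' hlt1 hlt2 (by positivity) (by positivity)
    _ = 4 ^ p * 4 ^ q * v * (u' * x) := by ring
    _ = _ := by rw [h4]

lemma card_sdiff_exchange {α : Type*} [DecidableEq α] {S T U : Finset α} {i j : α}
    (hiS : i ∈ S) (hiU : i ∈ U) (hiT : i ∉ T) (hjS : j ∉ S) (hWU : S ∩ T ⊆ U)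
    (hUST : U ⊆ S ∪ T) :
    (S \ ((U \ {i}) ∪ {j})).card = (S \ T).card - (U \ T).card + 1 := by
  have e1 : S \ ((U \ {i}) ∪ {j}) = insert i ((S \ T) \ (U \ T)) := by
    ext e
    have := @hWU e
    grind
  have hsub : U \ T ⊆ S \ T := fun e he => by
    have := @hUST e
    grind
  rw [e1, Finset.card_insert_of_notMem (by simp [hiU, hiT]),
    Finset.card_sdiff_of_subset hsub]

lemma exchange_eq_of_sdiff_eq_singleton {α : Type*} [DecidableEq α] {S T : Finset α} {i j : α}
    (hST : S \ T = {i}) (hTS : T \ S = {j}) : (S \ {i}) ∪ {j} = T := by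
  rw [← hST, ← hTS]
  grind

lemma card_sdiff_lt_of_between {α : Type*} [DecidableEq α] {S T U : Finset α}
    (hSU : S.card = U.card) (hne : U ≠ S) (hWU : S ∩ T ⊆ U) (hUST : U ⊆ S ∪ T) :
    (U \ T).card < (S \ T).card := by
  have hsub : U \ T ⊆ S \ T := fun e he => by
    have := @hUST e
    grind
  refine Finset.card_lt_card (hsub.ssubset_of_ne fun h => hne ?_)
  refine (Finset.eq_of_subset_of_card_le (fun e he => ?_) hSU.ge).symm
  have := congrArg (e ∈ ·) h
  have := @hWU e
  grind

lemma between_of_two_exchanges {α : Type*} [DecidableEq α] {S T U : Finset α} {i j l : α}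
    (hiU : i ∈ U) (hjT : j ∈ T) (hWU : S ∩ T ⊆ U)
    (hUST : U ⊆ S ∪ T) (hlV : l ∈ (U \ {i}) ∪ {j}) (hlS : l ∉ S) :
    l ∈ T ∧ S ∩ T ⊆ (((U \ {i}) ∪ {j}) \ {l}) ∪ {i} ∧
      (((U \ {i}) ∪ {j}) \ {l}) ∪ {i} ⊆ S ∪ T ∧
      ((((U \ {i}) ∪ {j}) \ {l}) ∪ {i}) \ T = U \ T := by
  have hlT : l ∈ T := by
    have := @hUST l
    grind
  refine ⟨hlT, fun e he => ?_, fun e he => ?_, ?_⟩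
  · have := @hWU e he
    grind
  · have := @hUST e
    grind
  · ext e
    grind

lemma weight_lt_weight_of_mul_lt {n : ℕ} {μ : Finset (Fin n) → ℝ} {t : Fin n → ℝ}
    {U V : Finset (Fin n)} {x y : ℝ} (hy : 0 < y) (hU : 0 < ∏ e ∈ U, t e)
    (hV : (∏ e ∈ V, t e) * y = (∏ e ∈ U, t e) * x) (h : μ U * y < μ V * x) :
    weight μ t U < weight μ t V := by
  refine lt_of_mul_lt_mul_right ?_ hy.le
  calc weight μ t U * y = μ U * y * ∏ e ∈ U, t e := by
        rw [weight]
        ring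
    _ < μ V * x * ∏ e ∈ U, t e := mul_lt_mul_of_pos_right h hU
    _ = weight μ t V * y := by
        rw [weight, mul_assoc _ _ y, hV]
        ring

/-- Approximate exchange with a constant depending on the exchange distance. -/
lemma exists_exchange {n k : ℕ} {μ : Finset (Fin n) → ℝ}
    (h0 : ∀ S, S.card = k → 0 ≤ μ S) (hlc : LogConcaveOn (genPoly n k μ)) (m : ℕ) :
    ∀ S T : Finset (Fin n), S.card = k → T.card = k → (S \ T).card = m + 1 →
      ∀ i ∈ S \ T, ∃ j ∈ T \ S,
        μ S * μ T ≤ 4 ^ m * (μ ((S \ {i}) ∪ {j}) * μ ((T \ {j}) ∪ {i})) := by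
  induction m using Nat.strong_induction_on with
  | _ m ih =>
  intro S T hS hT hd i hi
  obtain ⟨hiS, hiT⟩ := Finset.mem_sdiff.1 hi
  have hcard : (T \ S).card = m + 1 := (Finset.card_sdiff_comm (hT.trans hS.symm)).trans hd
  by_contra! hcon
  have hnnS : ∀ j ∈ T \ S, 0 ≤ μ ((S \ {i}) ∪ {j}) := fun j hj =>
    h0 _ ((card_exchange hiS (Finset.mem_sdiff.1 hj).2).trans hS)
  have hnnT : ∀ j ∈ T \ S, 0 ≤ μ ((T \ {j}) ∪ {i}) := fun j hj =>
    h0 _ ((card_exchange (Finset.mem_sdiff.1 hj).1 hiT).trans hT)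
  have hpos : 0 < μ S * μ T := by
    obtain ⟨j, hj⟩ := Finset.card_pos.1 (show 0 < (T \ S).card by omega)
    exact lt_of_le_of_lt
      (mul_nonneg (by positivity) (mul_nonneg (hnnS j hj) (hnnT j hj))) (hcon j hj)
  have hμS : 0 < μ S := pos_of_mul_pos_left hpos (h0 T hT)
  have hμT : 0 < μ T := pos_of_mul_pos_right hpos (h0 S hS)
  have hex : ∀ j, ∃ t : ℝ, 0 < t ∧ (j ∈ T \ S →
      2 ^ m * (μ ((S \ {i}) ∪ {j}) * t) < μ S ∧ 2 ^ m * μ ((T \ {j}) ∪ {i}) < μ T * t) := by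
    intro j
    by_cases hj : j ∈ T \ S
    · have h4 : ((2 : ℝ) ^ m) ^ 2 = 4 ^ m := by
        rw [← pow_mul, mul_comm, pow_mul]
        norm_num
      obtain ⟨t, ht, h1, h2⟩ := exists_pos_scaling (hnnS j hj) (hnnT j hj) hμS hμT
        (r := 2 ^ m) (by positivity) (by rw [h4]; exact hcon j hj)
      exact ⟨t, ht, fun _ => ⟨h1, h2⟩⟩
    · exact ⟨1, one_pos, fun h => absurd h hj⟩
  choose t ht htj using hex
  rcases (by omega : m = 0 ∨ m = 1 ∨ 2 ≤ m) with rfl | rfl | hm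
  · obtain ⟨j, hj⟩ := Finset.card_eq_one.1 hcard
    have hj' : j ∈ T \ S := by simp [hj]
    obtain ⟨a, ha⟩ := Finset.card_eq_one.1 hd
    have hi' := hi
    rw [ha, Finset.mem_singleton] at hi'
    have e1 := exchange_eq_of_sdiff_eq_singleton (hi' ▸ ha) hj
    have e2 := exchange_eq_of_sdiff_eq_singleton hj (hi' ▸ ha)
    have := hcon j hj'
    rw [e1, e2] at this
    linarith
  · exact not_small_exchange_of_card_sdiff_eq_two h0 hlc hS hT hμS hμT hd hiS hiT ht
      (fun j hj => by simpa using (htj j hj).1) (fun j hj => by simpa using (htj j hj).2)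
  obtain ⟨U₀, hU₀k, hμU₀, hU₀S, hWU₀, hU₀ST, hiU₀, hU₀2⟩ :=
    exists_intermediate h0 hlc hS hT hμS hμT (by omega) hiS hiT
  have hU₀m : (U₀ \ T).card ≤ m := by
    have := card_sdiff_lt_of_between (hS.trans hU₀k.symm) hU₀S hWU₀ hU₀ST
    omega
  have hne : ((powersetCard k univ).filter fun U => 0 < μ U ∧ S ∩ T ⊆ U ∧ U ⊆ S ∪ T ∧
      i ∈ U ∧ 2 ≤ (U \ T).card ∧ (U \ T).card ≤ m).Nonempty :=
    ⟨U₀, by simp [hU₀k, hμU₀, hWU₀, hU₀ST, hiU₀, hU₀2, hU₀m]⟩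
  obtain ⟨U, hU, hmax⟩ := Finset.exists_max_image _ (weight μ t) hne
  simp only [Finset.mem_filter, Finset.mem_powersetCard, Finset.subset_univ, true_and]
    at hU hmax
  obtain ⟨hUk, hμU, hWU, hUST, hiU, hu2, hum⟩ := hU
  obtain ⟨j, hj, hUT⟩ := ih ((U \ T).card - 1) (by omega) U T hUk hT (by omega) i
    (by simp [hiU, hiT])
  obtain ⟨hjT, hjU⟩ := Finset.mem_sdiff.1 hj
  have hjS : j ∉ S := fun h => hjU (hWU (Finset.mem_inter.2 ⟨h, hjT⟩))
  have hij : i ≠ j := fun h => hiT (h ▸ hjT)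
  set V := (U \ {i}) ∪ {j} with hV
  have hVk : V.card = k := (card_exchange hiU hjU).trans hUk
  have hiV : i ∉ V := by simp [hV, hij]
  have hSV : (S \ V).card = m + 1 - (U \ T).card + 1 := by
    rw [hV, card_sdiff_exchange hiS hiU hiT hjS hWU hUST, hd]
  obtain ⟨l, hl, hSVle⟩ := ih (m + 1 - (U \ T).card) (by omega) S V hS hVk hSV i
    (by simp [hiS, hiV])
  obtain ⟨hlV, hlS⟩ := Finset.mem_sdiff.1 hl
  obtain ⟨hlT, hWU', hUST', hU'T⟩ := between_of_two_exchanges hiU hjT hWU hUST hlV hlS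
  set U' := (V \ {l}) ∪ {i} with hU'
  have hU'k : U'.card = k := (card_exchange hlV hiV).trans hVk
  obtain ⟨-, hbj⟩ := htj j (by simp [hjT, hjS])
  obtain ⟨hal, -⟩ := htj l (by simp [hlT, hlS])
  have hμV := h0 V hVk
  have hlt : μ U * t l < μ U' * t j :=
    mul_lt_mul_of_two_exchanges (by omega) hμU hμS hμT hμV (h0 U' hU'k) (ht l) hUT hSVle
      hal hbj
  have hμU' : 0 < μ U' :=
    pos_of_mul_pos_left ((mul_pos hμU (ht l)).trans hlt) (ht j).le
  have hle := hmax U' ⟨hU'k, hμU', hWU', hUST', by simp [hU'], hU'T ▸ hu2, hU'T ▸ hum⟩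
  have hPU : (∏ e ∈ U', t e) * t l = (∏ e ∈ U, t e) * t j := by
    rw [hU', prod_exchange hlV hiV, hV, prod_exchange hiU hjU]
  exact hle.not_gt (weight_lt_weight_of_mul_lt (ht l) (Finset.prod_pos fun e _ => ht e)
    hPU hlt)

/-- **Approximate exchange for log-concave polynomials:** there is a universal constant `C > 1`
such that any `μ` with a log-concave generating polynomial satisfies `C^k`-approximate
exchange. -/
theorem log_concave_approx_exchange :
    ∃ C : ℝ, 1 < C ∧
      ∀ (n k : ℕ), 1 ≤ k → k ≤ n →
        ∀ μ : Finset (Fin n) → ℝ,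
          (∀ S : Finset (Fin n), S.card = k → 0 ≤ μ S) →
          LogConcaveOn (genPoly n k μ) →
          ApproxExchange n k (C ^ k) μ := by
  refine ⟨4, by norm_num, fun n k _ _ μ h0 hlc S T hS hT i hiS => ?_⟩
  by_cases hiT : i ∈ T
  · have e1 : (S \ {i}) ∪ {i} = S := Finset.sdiff_union_of_subset (by simpa using hiS)
    have e2 : (T \ {i}) ∪ {i} = T := Finset.sdiff_union_of_subset (by simpa using hiT)
    refine ⟨i, hiT, by rw [e1, hS], by rw [e2, hT], ?_⟩
    rw [e1, e2]
    exact le_mul_of_one_le_left (mul_nonneg (h0 S hS) (h0 T hT))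
      (one_le_pow₀ (by norm_num))
  · have hi : i ∈ S \ T := Finset.mem_sdiff.2 ⟨hiS, hiT⟩
    have hpos := Finset.card_pos.2 ⟨i, hi⟩
    have hle := Finset.card_le_card (Finset.sdiff_subset (s := S) (t := T))
    obtain ⟨j, hj, h⟩ := exists_exchange h0 hlc ((S \ T).card - 1) S T hS hT (by omega) i hi
    obtain ⟨hjT, hjS⟩ := Finset.mem_sdiff.1 hj
    have hSc := (card_exchange hiS hjS).trans hS
    have hTc := (card_exchange hjT hiT).trans hT
    refine ⟨j, hjT, hSc, hTc, h.trans ?_⟩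
    refine mul_le_mul_of_nonneg_right ?_ (mul_nonneg (h0 _ hSc) (h0 _ hTc))
    exact pow_le_pow_right₀ (by norm_num) (by omega)
end

section
/- Let μ be a nonnegative function on the 2-element subsets of {1,2,3,4} and suppose the quadratic polynomial g_μ(z_1,z_2,z_3,z_4) = ∑_{{i,j}⊆{1,2,3,4}, i≠j} μ({i,j})·z_i·z_j is log-concave on the nonnegative orthant. Then √(μ({1,2})·μ({3,4})) ≤ √(μ({1,3})·μ({2,4})) + √(μ({1,4})·μ({2,3})). -/
open Finset

/-- The infimum of `b * p + e / p` over `p > 0` is `2 * √(b * e)`. -/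
theorem le_two_mul_sqrt_add {b e K R : ℝ} (hb : 0 ≤ b) (he : 0 ≤ e)
    (h : ∀ p : ℝ, 0 < p → K ≤ b * p + e / p + R) : K ≤ 2 * Real.sqrt (b * e) + R := by
  refine le_of_forall_pos_le_add fun ε hε => ?_
  rcases hb.eq_or_lt with rfl | hb
  · rcases he.eq_or_lt with rfl | he
    · have := h 1 one_pos
      norm_num at this ⊢
      linarith
    · have := h (e / ε) (by positivity)
      rw [div_div_cancel₀ he.ne'] at this
      norm_num at this ⊢
      linarith
  · rcases he.eq_or_lt with rfl | he
    · have := h (ε / b) (by positivity)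
      rw [mul_div_cancel₀ _ hb.ne'] at this
      norm_num at this ⊢
      linarith
    · have hs : 0 < Real.sqrt (b * e) := Real.sqrt_pos.2 (by positivity)
      have hsq : Real.sqrt (b * e) ^ 2 = b * e := Real.sq_sqrt (by positivity)
      have := h (Real.sqrt (b * e) / b) (by positivity)
      have h1 : b * (Real.sqrt (b * e) / b) = Real.sqrt (b * e) := by field_simp
      have h2 : e / (Real.sqrt (b * e) / b) = Real.sqrt (b * e) := by
        rw [div_div_eq_mul_div, div_eq_iff hs.ne']
        linarith
      linarith

theorem genPoly_four_two (μ : Finset (Fin 4) → ℝ) (x : Fin 4 → ℝ) :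
    genPoly 4 2 μ x = μ {0, 1} * (x 0 * x 1) + μ {0, 2} * (x 0 * x 2) + μ {0, 3} * (x 0 * x 3)
      + μ {1, 2} * (x 1 * x 2) + μ {1, 3} * (x 1 * x 3) + μ {2, 3} * (x 2 * x 3) := by
  have h : Finset.powersetCard 2 (Finset.univ : Finset (Fin 4)) =
      {{0, 1}, {0, 2}, {0, 3}, {1, 2}, {1, 3}, {2, 3}} := by decide
  rw [genPoly, h]
  repeat rw [Finset.sum_insert (by decide)]
  rw [Finset.sum_singleton]
  repeat rw [Finset.prod_pair (by decide)]
  ring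

/-- Log-concavity at the midpoint of a point supported on `{0, 1}` and one supported on `{2, 3}`,
both normalised to lie on the level set `g = 1`. -/
theorem two_le_of_logConcaveOn_genPoly {μ : Finset (Fin 4) → ℝ}
    (hlc : LogConcaveOn (genPoly 4 2 μ)) (ha : 0 < μ {0, 1}) (hf : 0 < μ {2, 3})
    {p r : ℝ} (hp : 0 < p) (hr : 0 < r) :
    2 ≤ μ {0, 2} * p + μ {1, 3} / (μ {0, 1} * μ {2, 3}) / p
      + (μ {0, 3} / μ {2, 3} * r + μ {1, 2} / μ {0, 1} / r) := by
  obtain ⟨v, hv, hvp⟩ : ∃ v : ℝ, 0 < v ∧ p = r * v ^ 2 :=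
    ⟨Real.sqrt (p / r), Real.sqrt_pos.2 (by positivity), by
      rw [Real.sq_sqrt (by positivity)]
      field_simp⟩
  have h := hlc ![r * v, 1 / (μ {0, 1} * (r * v)), 0, 0] ![0, 0, v, 1 / (μ {2, 3} * v)]
    (by intro i; fin_cases i <;> simp <;> positivity)
    (by intro i; fin_cases i <;> simp <;> positivity) (1 / 2) (by norm_num) (by norm_num)
  have hx : genPoly 4 2 μ ![r * v, 1 / (μ {0, 1} * (r * v)), 0, 0] = 1 := by
    rw [genPoly_four_two]
    simp
    field_simp
  have hy : genPoly 4 2 μ ![0, 0, v, 1 / (μ {2, 3} * v)] = 1 := by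
    rw [genPoly_four_two]
    simp
    field_simp
  rw [hx, hy, Real.one_rpow, Real.one_rpow, genPoly_four_two] at h
  subst hvp
  have key : μ {0, 2} * (r * v ^ 2) + μ {1, 3} / (μ {0, 1} * μ {2, 3}) / (r * v ^ 2)
      + (μ {0, 3} / μ {2, 3} * r + μ {1, 2} / μ {0, 1} / r) =
      μ {0, 2} * (r * v * v) + μ {0, 3} * (r * v * (1 / (μ {2, 3} * v)))
      + μ {1, 2} * (1 / (μ {0, 1} * (r * v)) * v)
      + μ {1, 3} * (1 / (μ {0, 1} * (r * v)) * (1 / (μ {2, 3} * v))) := by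
    field_simp
    ring
  have h01 : μ {0, 1} * (r * v * (1 / (μ {0, 1} * (r * v)))) = 1 := by field_simp
  have h23 : μ {2, 3} * (v * (1 / (μ {2, 3} * v))) = 1 := by field_simp
  rw [key]
  simp only [Matrix.cons_val] at h
  linarith

/-- **The base case `k = 2`:** for a nonnegative `μ` on `2`-element subsets of a `4`-element
ground set with log-concave quadratic generating polynomial,
`√(μ{1,2}μ{3,4}) ≤ √(μ{1,3}μ{2,4}) + √(μ{1,4}μ{2,3})`. -/
theorem sqrt_exchange_of_log_concave_quadratic (μ : Finset (Fin 4) → ℝ)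
    (hnn : ∀ S : Finset (Fin 4), S.card = 2 → 0 ≤ μ S)
    (hlc : LogConcaveOn (genPoly 4 2 μ)) :
    Real.sqrt (μ {0, 1} * μ {2, 3}) ≤
      Real.sqrt (μ {0, 2} * μ {1, 3}) + Real.sqrt (μ {0, 3} * μ {1, 2}) := by
  have hb : 0 ≤ μ {0, 2} := hnn _ (by decide)
  have hc : 0 ≤ μ {0, 3} := hnn _ (by decide)
  have hd : 0 ≤ μ {1, 2} := hnn _ (by decide)
  have he : 0 ≤ μ {1, 3} := hnn _ (by decide)
  rcases (hnn {0, 1} (by decide)).eq_or_lt with ha | ha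
  · rw [← ha, zero_mul, Real.sqrt_zero]
    positivity
  rcases (hnn {2, 3} (by decide)).eq_or_lt with hf | hf
  · rw [← hf, mul_zero, Real.sqrt_zero]
    positivity
  have h1 : ∀ r : ℝ, 0 < r → 2 ≤ μ {0, 3} / μ {2, 3} * r + μ {1, 2} / μ {0, 1} / r
      + 2 * Real.sqrt (μ {0, 2} * (μ {1, 3} / (μ {0, 1} * μ {2, 3}))) := fun r hr => by
    rw [add_comm]
    exact le_two_mul_sqrt_add hb (by positivity) fun p hp =>
      two_le_of_logConcaveOn_genPoly hlc ha hf hp hr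
  have h2 := le_two_mul_sqrt_add (by positivity) (by positivity) h1
  have e1 : μ {0, 3} / μ {2, 3} * (μ {1, 2} / μ {0, 1}) =
      μ {0, 3} * μ {1, 2} / (μ {0, 1} * μ {2, 3}) := by
    field_simp
  have hs : 0 < Real.sqrt (μ {0, 1} * μ {2, 3}) := Real.sqrt_pos.2 (by positivity)
  rw [e1, ← mul_div_assoc, Real.sqrt_div (by positivity), Real.sqrt_div (by positivity),
    ← mul_add, ← add_div] at h2
  have h3 : 1 ≤ (Real.sqrt (μ {0, 3} * μ {1, 2}) + Real.sqrt (μ {0, 2} * μ {1, 3})) /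
      Real.sqrt (μ {0, 1} * μ {2, 3}) := by linarith
  rw [one_le_div hs] at h3
  linarith
end

section
/- Let v_1,…,v_n ∈ ℝ^k be vectors and define μ : 𝒞(n,k) → ℝ≥0 by μ(S) = det(M_S)², where for S = {i_1 < … < i_k}, M_S is the k×k matrix whose columns are v_{i_1},…,v_{i_k}. Then μ satisfies the k²-approximate exchange property: for every S, T ∈ 𝒞(n,k) and every i ∈ S there exists j ∈ T such that (S∖{i})∪{j} and (T∖{j})∪{i} both have k elements and μ(S)·μ(T) ≤ k²·μ((S∖{i})∪{j})·μ((T∖{j})∪{i}). -/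
open Finset

/-- The determinantal weight `μ(S) = det(M_S)²` where, for `S = {i₁ < … < i_k}`, the matrix
`M_S` has columns `v_{i₁}, …, v_{i_k}` (and `μ(S) = 0` for sets of the wrong size). -/
noncomputable def detSqMu (n k : ℕ) (v : Fin n → Fin k → ℝ) (S : Finset (Fin n)) : ℝ :=
  if h : S.card = k then
    (Matrix.det (Matrix.of fun r c : Fin k => v (S.orderIsoOfFin h c) r)) ^ 2
  else 0

/-- `detSqMu` can be computed from any injective enumeration of the set. -/
theorem detSqMu_image {n k : ℕ} (v : Fin n → Fin k → ℝ) {f : Fin k → Fin n}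
    (hf : Function.Injective f) {S : Finset (Fin n)} (hS : S.card = k) (hfS : ∀ c, f c ∈ S) :
    detSqMu n k v S = (Matrix.det (Matrix.of fun r c : Fin k => v (f c) r)) ^ 2 := by
  have hg : Function.Injective fun c => (S.orderIsoOfFin hS).symm ⟨f c, hfS c⟩ := by
    intro a b hab
    simpa using hf (Subtype.ext_iff.mp ((S.orderIsoOfFin hS).symm.injective hab))
  let σ : Equiv.Perm (Fin k) := Equiv.ofBijective _ (Finite.injective_iff_bijective.mp hg)
  have hσ : ∀ c, ((S.orderIsoOfFin hS (σ c) : S) : Fin n) = f c := fun c => by simp [σ]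
  have h := Matrix.det_permute' σ (Matrix.of fun r c : Fin k => v (S.orderIsoOfFin hS c) r)
  have hM : (Matrix.of fun r c : Fin k => v (S.orderIsoOfFin hS c) r).submatrix id σ =
      Matrix.of fun r c : Fin k => v (f c) r := by
    ext r c
    simp only [Matrix.submatrix_apply, Matrix.of_apply, id, hσ]
  rw [hM] at h
  rw [detSqMu, dif_pos hS, h, mul_pow]
  rcases Int.units_eq_one_or (Equiv.Perm.sign σ) with h1 | h1 <;> simp [h1]

theorem detSqMu_nonneg {n k : ℕ} (v : Fin n → Fin k → ℝ) (S : Finset (Fin n)) :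
    0 ≤ detSqMu n k v S := by
  unfold detSqMu
  split_ifs <;> positivity

/-- The determinantal exchange identity: swapping a column of `B` with each column of `A`. -/
theorem Matrix.det_mul_det_eq_sum_updateCol {ι R : Type*} [Fintype ι] [DecidableEq ι] [CommRing R]
    (A B : Matrix ι ι R) (a : ι) :
    A.det * B.det = ∑ c, (A.updateCol c (B.col a)).det * (B.updateCol a (A.col c)).det := by
  have h : B.cramer (A.mulVec (A.cramer (B.col a))) a = A.det * B.det := by
    rw [Matrix.mulVec_cramer, map_smul, Pi.smul_apply, Matrix.cramer_apply, smul_eq_mul]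
    congr 2
    exact Matrix.updateCol_eq_self B a
  have h2 : A.mulVec (A.cramer (B.col a)) = ∑ c, A.cramer (B.col a) c • A.col c := by
    ext r
    simp [Matrix.mulVec, dotProduct, mul_comm]
  rw [← h, h2, map_sum, Finset.sum_apply]
  simp only [Matrix.cramer_apply, Matrix.det_updateCol_smul]

theorem card_sdiff_singleton_union_singleton {α : Type*} [DecidableEq α] {S : Finset α} {i j : α}
    (hi : i ∈ S) (hj : j ∉ S) : ((S \ {i}) ∪ {j}).card = S.card := by
  rw [Finset.card_union_of_disjoint (by simp [hj]), Finset.card_sdiff_of_subset (by simpa using hi)]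
  have := Finset.card_pos.mpr ⟨i, hi⟩
  simp only [Finset.card_singleton]
  omega

/-- Exchanging one element of the set replaces one column of the matrix. -/
theorem detSqMu_exchange {n k : ℕ} (v : Fin n → Fin k → ℝ) {f : Fin k → Fin n}
    (hf : Function.Injective f) {S : Finset (Fin n)} (hS : S.card = k) (hfS : ∀ c, f c ∈ S)
    (a : Fin k) {j : Fin n} (hj : j ∉ S) :
    detSqMu n k v ((S \ {f a}) ∪ {j}) =
      ((Matrix.of fun r c : Fin k => v (f c) r).updateCol a (v j)).det ^ 2 := by
  have hinj : Function.Injective (Function.update f a j) := by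
    intro b c hbc
    have hne : ∀ d, f d ≠ j := fun d hd => hj (hd ▸ hfS d)
    by_cases hb : b = a <;> by_cases hc : c = a
    · rw [hb, hc]
    · subst hb
      simp only [Function.update_self, Function.update_of_ne hc] at hbc
      exact absurd hbc.symm (hne c)
    · subst hc
      simp only [Function.update_self, Function.update_of_ne hb] at hbc
      exact absurd hbc (hne b)
    · simp only [Function.update_of_ne hb, Function.update_of_ne hc] at hbc
      exact hf hbc
  rw [detSqMu_image v hinj ((card_sdiff_singleton_union_singleton (hfS a) hj).trans hS)]
  · congr 2
    ext r c
    by_cases hc : c = a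
    · subst hc; simp
    · simp [hc]
  · intro c
    by_cases hc : c = a
    · subst hc; simp
    · simp [hc, hfS c, hf.ne hc]

/-- **Determinantal point processes satisfy `k²`-approximate exchange.** -/
theorem detSq_approx_exchange (n k : ℕ) (hk1 : 1 ≤ k) (hkn : k ≤ n)
    (v : Fin n → Fin k → ℝ) :
    ApproxExchange n k ((k : ℝ) ^ 2) (detSqMu n k v) := by
  intro S T hS hT i hi
  have hk : (1 : ℝ) ≤ k := by exact_mod_cast hk1
  by_cases hiT : i ∈ T
  · have hS' : (S \ {i}) ∪ {i} = S := Finset.sdiff_union_of_subset (by simpa using hi)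
    have hT' : (T \ {i}) ∪ {i} = T := Finset.sdiff_union_of_subset (by simpa using hiT)
    refine ⟨i, hiT, by rw [hS', hS], by rw [hT', hT], ?_⟩
    rw [hS', hT']
    exact le_mul_of_one_le_left (mul_nonneg (detSqMu_nonneg v S) (detSqMu_nonneg v T))
      (one_le_pow₀ hk)
  suffices h : ∃ j ∈ T, j ∉ S ∧ detSqMu n k v S * detSqMu n k v T ≤ (k : ℝ) ^ 2 *
      (detSqMu n k v ((S \ {i}) ∪ {j}) * detSqMu n k v ((T \ {j}) ∪ {i})) by
    obtain ⟨j, hjT, hjS, h⟩ := h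
    exact ⟨j, hjT, (card_sdiff_singleton_union_singleton hi hjS).trans hS,
      (card_sdiff_singleton_union_singleton hjT hiT).trans hT, h⟩
  by_cases h0 : detSqMu n k v S * detSqMu n k v T = 0
  · obtain ⟨j, hjT, hjS⟩ : ∃ j ∈ T, j ∉ S := by
      by_contra! hsub
      exact hiT (Finset.eq_of_subset_of_card_le hsub (by rw [hS, hT]) ▸ hi)
    refine ⟨j, hjT, hjS, h0.trans_le ?_⟩
    exact mul_nonneg (by positivity) (mul_nonneg (detSqMu_nonneg v _) (detSqMu_nonneg v _))
  let f := S.orderEmbOfFin hS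
  let g := T.orderEmbOfFin hT
  have hf : ∀ c, f c ∈ S := S.orderEmbOfFin_mem hS
  have hg : ∀ c, g c ∈ T := T.orderEmbOfFin_mem hT
  obtain ⟨a, ha⟩ : ∃ a, f a = i := by
    have : i ∈ Set.range f := by rw [Finset.range_orderEmbOfFin]; exact hi
    exact this
  have hμS := detSqMu_image v f.injective hS hf
  have hμT := detSqMu_image v g.injective hT hg
  set B : Matrix (Fin k) (Fin k) ℝ := Matrix.of fun r c => v (f c) r with hB
  set A : Matrix (Fin k) (Fin k) ℝ := Matrix.of fun r c => v (g c) r with hA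
  have hBc : ∀ c, B.col c = v (f c) := fun c => rfl
  have hAc : ∀ c, A.col c = v (g c) := fun c => rfl
  have hsum := Matrix.det_mul_det_eq_sum_updateCol A B a
  obtain ⟨c, hc⟩ : ∃ c, |A.det * B.det| ≤
      k * |(A.updateCol c (B.col a)).det * (B.updateCol a (A.col c)).det| := by
    have : Nonempty (Fin k) := ⟨a⟩
    obtain ⟨c, -, hc⟩ := Finset.exists_max_image Finset.univ
      (fun c => |(A.updateCol c (B.col a)).det * (B.updateCol a (A.col c)).det|)
      Finset.univ_nonempty
    refine ⟨c, ?_⟩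
    rw [hsum]
    refine (Finset.abs_sum_le_sum_abs _ _).trans ((Finset.sum_le_card_nsmul _ _ _ hc).trans ?_)
    simp
  have hgS : g c ∉ S := by
    intro hmem
    have : g c ∈ Set.range f := by rw [Finset.range_orderEmbOfFin]; exact hmem
    obtain ⟨b, hb⟩ := this
    have hba : b ≠ a := by
      rintro rfl
      exact hiT (ha ▸ hb ▸ hg c)
    have hz : (B.updateCol a (A.col c)).det = 0 := by
      refine Matrix.det_zero_of_column_eq hba fun r => ?_
      rw [Matrix.updateCol_ne hba, Matrix.updateCol_self, hAc, ← hb]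
      rfl
    rw [hz, mul_zero, abs_zero, mul_zero] at hc
    have hAB := abs_nonpos_iff.mp hc
    apply h0
    rw [hμS, hμT, ← mul_pow, mul_comm, hAB]
    simp
  refine ⟨g c, hg c, hgS, ?_⟩
  have e1 := detSqMu_exchange v f.injective hS hf a hgS
  have e2 := detSqMu_exchange v g.injective hT hg c hiT
  rw [ha] at e1
  rw [e1, e2, hμS, hμT]
  have hsq := pow_le_pow_left₀ (abs_nonneg _) hc 2
  rw [mul_pow, sq_abs, sq_abs, hBc, hAc, ha] at hsq
  calc B.det ^ 2 * A.det ^ 2 = (A.det * B.det) ^ 2 := by ring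
    _ ≤ _ := hsq
    _ = _ := by rw [mul_pow, mul_comm (_ ^ 2) (_ ^ 2)]
end

section
/- Let A, B, C be nonnegative real numbers satisfying A² + B² + C² ≤ 2(AB + AC + BC). Then √A ≤ √B + √C. -/
/-- If nonnegative reals `A, B, C` satisfy `A² + B² + C² ≤ 2(AB + AC + BC)`,
then `√A ≤ √B + √C`. -/
theorem sqrt_le_sqrt_add_sqrt (A B C : ℝ) (hA : 0 ≤ A) (hB : 0 ≤ B) (hC : 0 ≤ C)
    (h : A ^ 2 + B ^ 2 + C ^ 2 ≤ 2 * (A * B + A * C + B * C)) :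
    Real.sqrt A ≤ Real.sqrt B + Real.sqrt C := by
  have hBC : A - B - C ≤ 2 * (√B * √C) := by
    refine abs_le_of_sq_le_sq' ?_ (by positivity) |>.2
    rw [mul_pow, mul_pow, Real.sq_sqrt hB, Real.sq_sqrt hC]
    linarith
  refine Real.sqrt_le_iff.mpr ⟨by positivity, ?_⟩
  rw [add_sq, Real.sq_sqrt hB, Real.sq_sqrt hC]
  linarith
end

section
/- Let H be a 4×4 real symmetric matrix all of whose entries are nonnegative, and suppose H has at most one positive eigenvalue (counted with multiplicity). Then det H ≤ 0. -/
/-- A finite product of nonpositive reals with an odd number of factors is nonpositive. -/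
theorem Finset.prod_nonpos_of_odd_card {ι : Type*} (s : Finset ι) (f : ι → ℝ)
    (hs : Odd s.card) (hf : ∀ i ∈ s, f i ≤ 0) : ∏ i ∈ s, f i ≤ 0 := by
  have h : 0 ≤ ∏ i ∈ s, -f i := Finset.prod_nonneg fun i hi => neg_nonneg.mpr (hf i hi)
  rw [Finset.prod_neg, hs.neg_one_pow] at h
  linarith

/-- A 4×4 real symmetric matrix with nonnegative entries and at most one positive
eigenvalue (counted with multiplicity) has nonpositive determinant. -/
theorem det_nonpos_of_nonneg_entries_of_at_most_one_pos_eigenvalue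
    (H : Matrix (Fin 4) (Fin 4) ℝ) (hH : H.IsHermitian)
    (hnn : ∀ i j, 0 ≤ H i j)
    (hpos : (Finset.univ.filter fun i => 0 < hH.eigenvalues i).card ≤ 1) :
    H.det ≤ 0 := by
  have htrace : 0 ≤ ∑ i, hH.eigenvalues i := by
    have h : H.trace = ∑ i, hH.eigenvalues i := hH.trace_eq_sum_eigenvalues
    exact h ▸ Finset.sum_nonneg fun i _ => hnn i i
  have hdet : H.det = ∏ i, hH.eigenvalues i := hH.det_eq_prod_eigenvalues
  obtain ⟨i, -, hi⟩ : ∃ i ∈ Finset.univ, 0 ≤ hH.eigenvalues i :=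
    Finset.exists_le_of_sum_le Finset.univ_nonempty (by simpa using htrace)
  rw [hdet, ← Finset.mul_prod_erase _ _ (Finset.mem_univ i)]
  rcases hi.eq_or_lt with hzero | hlt
  · simp [← hzero]
  · refine mul_nonpos_of_nonneg_of_nonpos hi
      (Finset.prod_nonpos_of_odd_card _ _ (by simp; decide) fun j hj => ?_)
    by_contra! hj'
    exact Finset.ne_of_mem_erase hj
      (Finset.card_le_one.mp hpos j (by simpa using hj') i (by simpa using hlt))
end
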